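/- Let H be a subgroup of the semidirect product ({−1,1})^p ⋊ S_p and χ : H → K^× a character, such that for every (ε, γ) ∈ H one has n_{γ(i)} = n_i and A_{γ(i)} = A_i for all i, and the rational function R(k_1, …, k_p) = P(k_1, …, k_p)/((k_1+r_1)_{n_1+1}^{A_1} ⋯ (k_p+r_p)_{n_p+1}^{A_p}), viewed as a function of K_1, …, K_p, satisfies R(ε_{γ(1)} K_{γ(1)}, …, ε_{γ(p)} K_{γ(p)}) = χ(ε, γ) · R(K_1, …, K_p). Assume condition (9). Then there exist a K-linear combination L of multiple zeta values of depth at most p − 1 and a family of coefficients λ[s_1, …, s_p] ∈ K, defined for all integers s_1, …, s_p ≥ 1 and vanishing unless s_1 ≥ 2 and 1 ≤ s_i ≤ A_i for every i, such that S(P) = L + Σ λ[s_1, …, s_p] ζ(s_1, …, s_p), and such that for every (ε, γ) ∈ H and all s_1, …, s_p ≥ 1: ε_1^{s_1} ⋯ ε_p^{s_p} · λ[s_{γ(1)}, …, s_{γ(p)}] = χ(ε, γ) · λ[s_1, …, s_p]. -/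

import Mathlib

/-- The multiple zeta value `ζ(s₁, …, s_q)`, defined as a sum over strictly
decreasing tuples `k₁ > k₂ > … > k_q ≥ 1`.  For the empty list it equals `1`. -/
noncomputable def mzv (s : List ℕ) : ℝ :=
  ∑' k : {k : Fin s.length → ℕ // StrictAnti k ∧ ∀ i, 1 ≤ k i},
    ∏ i : Fin s.length, ((k.1 i : ℝ) ^ s.get i)⁻¹

/-- The rational function `P(k₁,…,k_p) / ∏ᵢ ((kᵢ+rᵢ)_{nᵢ+1})^{Aᵢ}`. -/
noncomputable def Rfun (p : ℕ) (K : Subfield ℂ) (A n r : ℕ → ℕ)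
    (P : MvPolynomial (Fin p) K) (k : Fin p → ℂ) : ℂ :=
  MvPolynomial.eval₂ K.subtype k P /
    ∏ i : Fin p, ((ascPochhammer ℂ (n i.1 + 1)).eval (k i + (r i.1 : ℂ))) ^ A i.1

/-- The automorphism of `(Fin p → ℤˣ)` given by permuting the coordinates by `γ`. -/
def permMulAut (p : ℕ) (γ : Equiv.Perm (Fin p)) : MulAut (Fin p → ℤˣ) where
  toFun ε := ε ∘ γ.symm
  invFun ε := ε ∘ γ
  left_inv ε := by ext i; simp
  right_inv ε := by ext i; simp
  map_mul' ε ε' := rfl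

/-- The action of `S_p` on `({-1,1})^p` (realized as `Fin p → ℤˣ`) by permutation
of the coordinates, as a homomorphism to the automorphism group; it defines the
semidirect product `(ℤ/2ℤ)^p ⋊ S_p`. -/
def permHom (p : ℕ) : Equiv.Perm (Fin p) →* MulAut (Fin p → ℤˣ) where
  toFun := permMulAut p
  map_one' := by ext ε i; rfl
  map_mul' γ γ' := by ext ε i; rfl

namespace NestedSum

open Finset Filter Topology

section Truncated

variable {R : Type*} [CommRing R]

/-- The truncated non-strict nested sum `∑ f₁(m₁) ⋯ f_p(m_p)` over `N > m₁ ≥ ⋯ ≥ m_p ≥ 0`. -/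
def weak : List (ℕ → R) → ℕ → R
  | [], _ => 1
  | f :: l, N => ∑ m ∈ range N, f m * weak l (m + 1)

/-- The truncated strict nested sum `∑ f₁(m₁) ⋯ f_p(m_p)` over `N > m₁ > ⋯ > m_p ≥ 0`. -/
def strict : List (ℕ → R) → ℕ → R
  | [], _ => 1
  | f :: l, N => ∑ m ∈ range N, f m * strict l m

@[simp] lemma weak_nil (N : ℕ) : weak ([] : List (ℕ → R)) N = 1 := rfl

lemma weak_cons (f : ℕ → R) (l : List (ℕ → R)) (N : ℕ) :
    weak (f :: l) N = ∑ m ∈ range N, f m * weak l (m + 1) := rfl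

@[simp] lemma strict_nil (N : ℕ) : strict ([] : List (ℕ → R)) N = 1 := rfl

lemma strict_cons (f : ℕ → R) (l : List (ℕ → R)) (N : ℕ) :
    strict (f :: l) N = ∑ m ∈ range N, f m * strict l m := rfl

lemma weak_cons_succ (f : ℕ → R) (l : List (ℕ → R)) (N : ℕ) :
    weak (f :: l) (N + 1) = weak (f :: l) N + f N * weak l (N + 1) := by
  rw [weak_cons, sum_range_succ, ← weak_cons]

/-- The forward difference operator. -/
def diff (G : ℕ → R) : ℕ → R := fun m => G (m + 1) - G m

lemma weak_append_congr {X Y Z : List (ℕ → R)} {c : R}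
    (h : ∀ N, weak X N = weak Y N + c * weak Z N) (l : List (ℕ → R)) (N : ℕ) :
    weak (l ++ X) N = weak (l ++ Y) N + c * weak (l ++ Z) N := by
  induction l generalizing N with
  | nil => simpa using h N
  | cons f l ih =>
    simp only [List.cons_append, weak_cons, ih, mul_add, sum_add_distrib, mul_sum]
    congr 1
    exact sum_congr rfl fun _ _ => by ring

lemma weak_cons_add (f g : ℕ → R) (l : List (ℕ → R)) (N : ℕ) :
    weak ((f + g) :: l) N = weak (f :: l) N + 1 * weak (g :: l) N := by
  simp [weak_cons, add_mul, sum_add_distrib]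

lemma weak_diff_singleton (G : ℕ → R) (N : ℕ) : weak [diff G] N = G N - G 0 := by
  simpa [weak_cons, diff, -sum_sub_distrib] using sum_range_sub G N

lemma weak_diff_cons_cons (G f : ℕ → R) (l : List (ℕ → R)) (N : ℕ) :
    weak (diff G :: f :: l) N = G N * weak (f :: l) N - weak ((G * f) :: l) N := by
  induction N with
  | zero => simp [weak_cons]
  | succ N ih =>
    rw [weak_cons_succ, ih, weak_cons_succ f, weak_cons_succ (G * f), diff, Pi.mul_apply]
    ring

lemma weak_cons_diff_singleton (u G : ℕ → R) (N : ℕ) :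
    weak [u, diff G] N = weak [u * fun m => G (m + 1)] N + (-G 0) * weak [u] N := by
  rw [weak_cons, weak_cons, weak_cons, mul_sum, ← sum_add_distrib]
  refine sum_congr rfl fun m _ => ?_
  rw [weak_diff_singleton]
  simp only [Pi.mul_apply, weak_nil]
  ring

lemma weak_cons_diff_cons_cons (u G f : ℕ → R) (l : List (ℕ → R)) (N : ℕ) :
    weak (u :: diff G :: f :: l) N =
      weak ((u * fun m => G (m + 1)) :: f :: l) N + (-1) * weak (u :: (G * f) :: l) N := by
  rw [weak_cons, weak_cons, weak_cons u, mul_sum, ← sum_add_distrib]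
  refine sum_congr rfl fun m _ => ?_
  rw [weak_diff_cons_cons]
  simp only [Pi.mul_apply]
  ring

lemma weak_cons_cons (f g : ℕ → R) (l : List (ℕ → R)) (N : ℕ) :
    weak (f :: g :: l) N =
      ∑ m ∈ range N, f m * weak (g :: l) m + weak ((f * g) :: l) N := by
  rw [weak_cons, weak_cons (f * g), ← sum_add_distrib]
  refine sum_congr rfl fun m _ => ?_
  rw [weak_cons_succ, Pi.mul_apply]
  ring

open Classical in
/-- The tuples of integers in `[1, N]` which satisfy `S`. -/
noncomputable def box (p : ℕ) (S : (Fin p → ℕ) → Prop) (N : ℕ) : Finset (Fin p → ℕ) :=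
  (Fintype.piFinset fun _ => Icc 1 N).filter S

lemma mem_box {p : ℕ} {S : (Fin p → ℕ) → Prop} {N : ℕ} {k : Fin p → ℕ} :
    k ∈ box p S N ↔ (∀ i, 1 ≤ k i ∧ k i ≤ N) ∧ S k := by
  simp [box]

lemma sum_box_antitone_succ (p N : ℕ) (φ : (Fin (p + 1) → ℕ) → R) :
    ∑ k ∈ box (p + 1) Antitone N, φ k =
      ∑ m ∈ range N, ∑ k ∈ box p Antitone (m + 1), φ (Fin.cons (m + 1) k) := by
  rw [sum_sigma']
  refine (sum_bij' (fun x _ => Fin.cons (x.1 + 1) x.2) (fun k _ => ⟨k 0 - 1, Fin.tail k⟩)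
    ?_ ?_ ?_ ?_ ?_).symm
  · rintro ⟨m, k⟩ h
    simp only [mem_sigma, mem_range, mem_box] at h ⊢
    obtain ⟨hm, hk, ha⟩ := h
    refine ⟨fun i => ?_, ?_⟩
    · refine Fin.cases ?_ (fun i => ?_) i
      · simp; omega
      · simpa using ⟨(hk i).1, (hk i).2.trans (by omega)⟩
    · intro i j hij
      revert hij
      refine Fin.cases ?_ (fun i => ?_) i <;> refine Fin.cases ?_ (fun j => ?_) j
      · simp
      · intro _; simpa using (hk j).2
      · intro h; simp at h
      · intro h; simpa using ha (Fin.succ_le_succ_iff.1 h)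
  · intro k h
    simp only [mem_sigma, mem_range, mem_box] at h ⊢
    obtain ⟨hk, ha⟩ := h
    have h0 := hk 0
    refine ⟨by omega, fun i => ⟨(hk i.succ).1, ?_⟩, fun i j hij => ?_⟩
    · have : k i.succ ≤ k 0 := ha (Fin.zero_le _)
      simp only [Fin.tail]; omega
    · exact ha (Fin.succ_le_succ_iff.2 hij)
  · rintro ⟨m, k⟩ h; simp
  · intro k h
    have h0 := (mem_box.1 h).1 0
    rw [show k 0 - 1 + 1 = k 0 by omega]
    exact Fin.cons_self_tail k
  · rintro ⟨m, k⟩ h; rfl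

lemma sum_box_strictAnti_succ (p N : ℕ) (φ : (Fin (p + 1) → ℕ) → R) :
    ∑ k ∈ box (p + 1) StrictAnti N, φ k =
      ∑ m ∈ range N, ∑ k ∈ box p StrictAnti m, φ (Fin.cons (m + 1) k) := by
  rw [sum_sigma']
  refine (sum_bij' (fun x _ => Fin.cons (x.1 + 1) x.2) (fun k _ => ⟨k 0 - 1, Fin.tail k⟩)
    ?_ ?_ ?_ ?_ ?_).symm
  · rintro ⟨m, k⟩ h
    simp only [mem_sigma, mem_range, mem_box] at h ⊢
    obtain ⟨hm, hk, ha⟩ := h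
    refine ⟨fun i => ?_, ?_⟩
    · refine Fin.cases ?_ (fun i => ?_) i
      · simp; omega
      · simpa using ⟨(hk i).1, (hk i).2.trans (by omega)⟩
    · intro i j hij
      revert hij
      refine Fin.cases ?_ (fun i => ?_) i <;> refine Fin.cases ?_ (fun j => ?_) j
      · simp
      · intro _; simpa [Nat.lt_succ_iff] using (hk j).2
      · intro h; simp at h
      · intro h; simpa using ha (Fin.succ_lt_succ_iff.1 h)
  · intro k h
    simp only [mem_sigma, mem_range, mem_box] at h ⊢
    obtain ⟨hk, ha⟩ := h
    have h0 := hk 0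
    refine ⟨by omega, fun i => ⟨(hk i.succ).1, ?_⟩, fun i j hij => ?_⟩
    · have : k i.succ < k 0 := ha (Fin.succ_pos _)
      simp only [Fin.tail]; omega
    · exact ha (Fin.succ_lt_succ_iff.2 hij)
  · rintro ⟨m, k⟩ h; simp
  · intro k h
    have h0 := (mem_box.1 h).1 0
    rw [show k 0 - 1 + 1 = k 0 by omega]
    exact Fin.cons_self_tail k
  · rintro ⟨m, k⟩ h; rfl

lemma weak_ofFn (p : ℕ) (f : Fin p → ℕ → R) (N : ℕ) :
    weak (List.ofFn f) N = ∑ k ∈ box p Antitone N, ∏ i, f i (k i - 1) := by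
  induction p generalizing N with
  | zero =>
    have : box 0 Antitone N = univ := by
      ext k; simpa [mem_box, Subsingleton.antitone] using Subsingleton.elim _ _
    simp [this]
  | succ p ih =>
    rw [List.ofFn_succ, weak_cons, sum_box_antitone_succ]
    refine sum_congr rfl fun m _ => ?_
    rw [ih, mul_sum]
    exact sum_congr rfl fun k _ => by simp [Fin.prod_univ_succ]

lemma strict_ofFn (p : ℕ) (f : Fin p → ℕ → R) (N : ℕ) :
    strict (List.ofFn f) N = ∑ k ∈ box p StrictAnti N, ∏ i, f i (k i - 1) := by
  induction p generalizing N with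
  | zero =>
    have : box 0 StrictAnti N = univ := by
      ext k; simpa [mem_box, Subsingleton.strictAnti] using Subsingleton.elim _ _
    simp [this]
  | succ p ih =>
    rw [List.ofFn_succ, strict_cons, sum_box_strictAnti_succ]
    refine sum_congr rfl fun m _ => ?_
    rw [ih, mul_sum]
    exact sum_congr rfl fun k _ => by simp [Fin.prod_univ_succ]

end Truncated

section Growth

/-- `f m` is `O(m ^ d)`. -/
def Growth (d : ℤ) (f : ℕ → ℂ) : Prop :=
  ∃ C : ℝ, 0 ≤ C ∧ ∀ m : ℕ, ‖f m‖ ≤ C * ((m : ℝ) + 1) ^ d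

lemma Growth.mono {d e : ℤ} {f : ℕ → ℂ} (h : Growth d f) (hde : d ≤ e) : Growth e f := by
  obtain ⟨C, hC, h⟩ := h
  refine ⟨C, hC, fun m => (h m).trans ?_⟩
  gcongr
  linarith [Nat.cast_nonneg (α := ℝ) m]

lemma Growth.add {d : ℤ} {f g : ℕ → ℂ} (hf : Growth d f) (hg : Growth d g) :
    Growth d (f + g) := by
  obtain ⟨C, hC, hf⟩ := hf
  obtain ⟨C', hC', hg⟩ := hg
  refine ⟨C + C', by positivity, fun m => (norm_add_le _ _).trans ?_⟩
  rw [add_mul]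
  exact add_le_add (hf m) (hg m)

lemma Growth.const_mul {d : ℤ} {f : ℕ → ℂ} (c : ℂ) (hf : Growth d f) :
    Growth d (fun m => c * f m) := by
  obtain ⟨C, hC, hf⟩ := hf
  refine ⟨‖c‖ * C, by positivity, fun m => ?_⟩
  rw [norm_mul, mul_assoc]
  exact mul_le_mul_of_nonneg_left (hf m) (norm_nonneg _)

lemma Growth.sub {d : ℤ} {f g : ℕ → ℂ} (hf : Growth d f) (hg : Growth d g) :
    Growth d (f - g) := by
  have := hf.add (hg.const_mul (-1))
  convert this using 1
  ext m
  simp [sub_eq_add_neg]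

lemma Growth.zero (d : ℤ) : Growth d 0 := ⟨0, le_rfl, by simp⟩

lemma Growth.sum {ι : Type*} {d : ℤ} (s : Finset ι) {f : ι → ℕ → ℂ}
    (h : ∀ i ∈ s, Growth d (f i)) : Growth d (∑ i ∈ s, f i) := by
  classical
  induction s using Finset.induction_on with
  | empty => simpa using Growth.zero d
  | insert a s ha ih =>
    rw [sum_insert ha]
    exact (h a (mem_insert_self _ _)).add (ih fun i hi => h i (mem_insert_of_mem hi))

lemma Growth.mul {d e : ℤ} {f g : ℕ → ℂ} (hf : Growth d f) (hg : Growth e g) :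
    Growth (d + e) (f * g) := by
  obtain ⟨C, hC, hf⟩ := hf
  obtain ⟨C', hC', hg⟩ := hg
  refine ⟨C * C', by positivity, fun m => ?_⟩
  rw [Pi.mul_apply, norm_mul, zpow_add₀ (by positivity), mul_mul_mul_comm]
  exact mul_le_mul (hf m) (hg m) (norm_nonneg _) (by positivity)

lemma Growth.shift {d : ℤ} {f : ℕ → ℂ} (hf : Growth d f) : Growth d (fun m => f (m + 1)) := by
  obtain ⟨C, hC, hf⟩ := hf
  refine ⟨C * 2 ^ |d|, by positivity, fun m => (hf (m + 1)).trans ?_⟩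
  rw [mul_assoc]
  gcongr
  push_cast
  rcases le_total 0 d with hd | hd
  · rw [abs_of_nonneg hd, ← mul_zpow]
    exact zpow_le_zpow_left₀ hd (by positivity) (by linarith [Nat.cast_nonneg (α := ℝ) m])
  · have h1 : ((m : ℝ) + 1 + 1) ^ d ≤ ((m : ℝ) + 1) ^ d := by
      obtain ⟨n, rfl⟩ : ∃ n : ℕ, d = -n := ⟨(-d).toNat, by omega⟩
      simp only [zpow_neg, zpow_natCast]
      gcongr
      linarith
    refine h1.trans (le_mul_of_one_le_left (by positivity) ?_)
    exact one_le_zpow₀ (by norm_num) (abs_nonneg _)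

lemma Growth.tendsto_zero {f : ℕ → ℂ} (hf : Growth (-1) f) : Tendsto f atTop (𝓝 0) := by
  obtain ⟨C, hC, hf⟩ := hf
  refine squeeze_zero_norm hf ?_
  simpa [zpow_neg_one, one_div] using
    (tendsto_one_div_add_atTop_nhds_zero_nat (𝕜 := ℝ)).const_mul C

lemma Growth.sum_range {d : ℤ} (hd : 0 ≤ d) {f : ℕ → ℂ} (hf : Growth d f) :
    Growth (d + 1) (fun m => ∑ j ∈ range m, f j) := by
  obtain ⟨C, hC, hf⟩ := hf
  refine ⟨C, hC, fun m => (norm_sum_le _ _).trans ?_⟩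
  calc ∑ j ∈ range m, ‖f j‖ ≤ ∑ j ∈ range m, C * ((m : ℝ) + 1) ^ d := by
        refine sum_le_sum fun j hj => (hf j).trans ?_
        have : (j : ℝ) ≤ m := by exact_mod_cast (mem_range.1 hj).le
        exact mul_le_mul_of_nonneg_left
          (zpow_le_zpow_left₀ hd (by positivity) (by linarith)) hC
    _ = m * (C * ((m : ℝ) + 1) ^ d) := by simp
    _ ≤ ((m : ℝ) + 1) * (C * ((m : ℝ) + 1) ^ d) := by gcongr; linarith
    _ = C * ((m : ℝ) + 1) ^ (d + 1) := by rw [zpow_add_one₀ (by positivity)]; ring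

/-- The partial sums of `d + 1`, started at `D` and taken along the list, are at most `-1`. -/
def Admissible : ℤ → List ℤ → Prop
  | _, [] => True
  | D, d :: l => D + d + 1 ≤ -1 ∧ Admissible (D + d + 1) l

lemma Admissible.append_congr {X Y : List ℤ} (h : ∀ D, Admissible D X → Admissible D Y)
    (l : List ℤ) : ∀ D, Admissible D (l ++ X) → Admissible D (l ++ Y) := by
  induction l with
  | nil => exact h
  | cons d l ih => exact fun D hD => ⟨hD.1, ih _ hD.2⟩

lemma admissible_ofFn {p : ℕ} (d : Fin p → ℤ) (D : ℤ) :
    Admissible D (List.ofFn d) ↔ ∀ j : Fin p, D + ∑ i ∈ Iic j, (d i + 1) ≤ -1 := by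
  induction p generalizing D with
  | zero => simp [Admissible]
  | succ p ih =>
    rw [List.ofFn_succ, Admissible, ih, Fin.forall_fin_succ]
    refine and_congr ?_ (forall_congr' fun j => ?_)
    · have : Iic (0 : Fin (p + 1)) = {0} := by ext i; simp
      simp [this, add_assoc]
    · have : ∑ i ∈ Iic j.succ, (d i + 1) = (d 0 + 1) + ∑ i ∈ Iic j, (d i.succ + 1) := by
        have h (q : ℕ) (j : Fin q) (f : Fin q → ℤ) :
            ∑ i ∈ Iic j, f i = ∑ i, if i ≤ j then f i else 0 := by
          rw [← sum_filter]; congr 1; ext; simp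
        rw [h, h, Fin.sum_univ_succ]
        simp
      rw [this]
      constructor <;> intro h <;> linarith

/-- The shifted harmonic numbers `∑_{m ≤ N} 1 / (m + 1)`. -/
noncomputable def harm (N : ℕ) : ℝ := ∑ m ∈ range (N + 1), ((m : ℝ) + 1)⁻¹

lemma harm_nonneg (N : ℕ) : 0 ≤ harm N := sum_nonneg fun _ _ => by positivity

lemma harm_mono : Monotone harm := fun _ _ h =>
  sum_le_sum_of_subset_of_nonneg (range_mono (by omega)) fun _ _ _ => by positivity

lemma harm_pow_le (q : ℕ) :
    ∃ C : ℝ, 0 ≤ C ∧ ∀ N : ℕ, harm N ^ q ≤ C * ((N : ℝ) + 1) ^ (1 / 2 : ℝ) := by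
  set ε : ℝ := 1 / (2 * ((q : ℝ) + 1)) with hε
  have hε0 : 0 < ε := by positivity
  refine ⟨(1 + 1 / ε) ^ q, by positivity, fun N => ?_⟩
  have h1 : harm N ≤ 1 + Real.log ((N : ℝ) + 1) := by
    have := harmonic_le_one_add_log (N + 1)
    rw [harmonic] at this
    push_cast at this
    simpa [harm] using this
  have hN : (1 : ℝ) ≤ (N : ℝ) + 1 := by linarith [Nat.cast_nonneg (α := ℝ) N]
  have h2 : harm N ≤ (1 + 1 / ε) * ((N : ℝ) + 1) ^ ε := by
    have h3 := Real.log_le_rpow_div (x := (N : ℝ) + 1) (by positivity) hε0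
    have h4 := Real.one_le_rpow hN hε0.le
    calc harm N ≤ 1 + Real.log ((N : ℝ) + 1) := h1
      _ ≤ ((N : ℝ) + 1) ^ ε + ((N : ℝ) + 1) ^ ε / ε := add_le_add h4 h3
      _ = _ := by ring
  calc harm N ^ q ≤ ((1 + 1 / ε) * ((N : ℝ) + 1) ^ ε) ^ q :=
        pow_le_pow_left₀ (harm_nonneg N) h2 q
    _ = (1 + 1 / ε) ^ q * ((N : ℝ) + 1) ^ (ε * q) := by
        rw [mul_pow, ← Real.rpow_natCast (((N : ℝ) + 1) ^ ε), ← Real.rpow_mul (by positivity)]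
    _ ≤ (1 + 1 / ε) ^ q * ((N : ℝ) + 1) ^ (1 / 2 : ℝ) := by
        gcongr
        rw [hε, one_div_mul_eq_div, div_le_div_iff₀ (by positivity) (by norm_num)]
        linarith

/-- The list of the absolute values. -/
noncomputable def absList (l : List (ℕ → ℂ)) : List (ℕ → ℝ) := l.map fun f m => ‖f m‖

lemma weak_absList_nonneg (l : List (ℕ → ℂ)) (N : ℕ) : 0 ≤ weak (absList l) N := by
  induction l generalizing N with
  | nil => simp [absList]
  | cons f l ih => exact sum_nonneg fun m _ => mul_nonneg (norm_nonneg _) (ih _)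

lemma norm_weak_le (l : List (ℕ → ℂ)) (N : ℕ) : ‖weak l N‖ ≤ weak (absList l) N := by
  induction l generalizing N with
  | nil => simp [absList]
  | cons f l ih =>
    refine (norm_sum_le _ _).trans (sum_le_sum fun m _ => ?_)
    rw [norm_mul]
    exact mul_le_mul_of_nonneg_left (ih _) (norm_nonneg _)

/-- A function together with an exponent. -/
abbrev Entry := (ℕ → ℂ) × ℤ

lemma weak_absList_le (l : List Entry) (hl : ∀ e ∈ l, Growth e.2 e.1) {D : ℤ} (hD : D ≤ -1)
    (hadm : Admissible D (l.map Prod.snd)) : ∃ C : ℝ, 0 ≤ C ∧ ∀ N : ℕ,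
      weak (absList (l.map Prod.fst)) (N + 1) ≤
        C * ((N : ℝ) + 1) ^ (-D - 1) * harm N ^ l.length := by
  induction l generalizing D with
  | nil =>
    refine ⟨1, zero_le_one, fun N => ?_⟩
    simp only [absList, List.map_nil, weak_nil, List.length_nil, pow_zero, mul_one, one_mul]
    exact one_le_zpow₀ (by linarith [Nat.cast_nonneg (α := ℝ) N]) (by omega)
  | cons e l ih =>
    obtain ⟨f, d⟩ := e
    obtain ⟨hd, hadm⟩ := hadm
    obtain ⟨C, hC, hf⟩ := hl _ List.mem_cons_self
    obtain ⟨C', hC', h⟩ := ih (fun e he => hl e (List.mem_cons_of_mem _ he)) hd hadm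
    refine ⟨C * C', by positivity, fun N => ?_⟩
    have key : ∀ m ∈ range (N + 1), ‖f m‖ * weak (absList (l.map Prod.fst)) (m + 1) ≤
        C * C' * ((N : ℝ) + 1) ^ (-D - 1) * harm N ^ l.length * ((m : ℝ) + 1)⁻¹ := by
      intro m hm
      have hmN : m ≤ N := by simpa [Nat.lt_succ_iff] using hm
      calc ‖f m‖ * weak (absList (l.map Prod.fst)) (m + 1)
          ≤ (C * ((m : ℝ) + 1) ^ d) *
            (C' * ((m : ℝ) + 1) ^ (-(D + d + 1) - 1) * harm m ^ l.length) :=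
            mul_le_mul (hf m) (h m) (weak_absList_nonneg _ _) (by positivity)
        _ = C * C' * ((m : ℝ) + 1) ^ (-D - 1) * harm m ^ l.length * ((m : ℝ) + 1)⁻¹ := by
            have : ((m : ℝ) + 1) ^ (-D - 1) * ((m : ℝ) + 1)⁻¹ =
                ((m : ℝ) + 1) ^ d * ((m : ℝ) + 1) ^ (-(D + d + 1) - 1) := by
              rw [← zpow_neg_one, ← zpow_add₀ (by positivity), ← zpow_add₀ (by positivity)]
              congr 1; ring
            linear_combination (-C * C' * harm m ^ l.length) * this
        _ ≤ _ := by
            have h1 : ((m : ℝ) + 1) ^ (-D - 1) ≤ ((N : ℝ) + 1) ^ (-D - 1) := by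
              have : (m : ℝ) ≤ N := by exact_mod_cast hmN
              exact zpow_le_zpow_left₀ (by omega) (by positivity) (by linarith)
            have h2 : harm m ^ l.length ≤ harm N ^ l.length :=
              pow_le_pow_left₀ (harm_nonneg m) (harm_mono hmN) _
            have h3 := pow_nonneg (harm_nonneg m) l.length
            gcongr
    refine (sum_le_sum key).trans ?_
    rw [← mul_sum, ← harm, List.length_cons, pow_succ, ← mul_assoc]

lemma tendsto_mul_weak (G : ℕ → ℂ) {D : ℤ} (hD : D ≤ -1) (hG : Growth D G) (l : List Entry)
    (hl : ∀ e ∈ l, Growth e.2 e.1) (hadm : Admissible D (l.map Prod.snd)) :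
    Tendsto (fun N => G N * weak (l.map Prod.fst) N) atTop (𝓝 0) := by
  rw [← tendsto_add_atTop_iff_nat 1]
  obtain ⟨C, hC, hG⟩ := hG.shift
  obtain ⟨C', hC', h⟩ := weak_absList_le l hl hD hadm
  obtain ⟨C'', hC'', hh⟩ := harm_pow_le l.length
  refine squeeze_zero_norm (a := fun N : ℕ => C * C' * C'' * ((N : ℝ) + 1) ^ (-(1 / 2) : ℝ))
    (fun N => ?_) ?_
  · rw [norm_mul]
    have hp : (0 : ℝ) < (N : ℝ) + 1 := by positivity
    calc ‖G (N + 1)‖ * ‖weak (l.map Prod.fst) (N + 1)‖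
        ≤ (C * ((N : ℝ) + 1) ^ D) *
          (C' * ((N : ℝ) + 1) ^ (-D - 1) * harm N ^ l.length) :=
          mul_le_mul (hG N) ((norm_weak_le _ _).trans (h N)) (norm_nonneg _) (by positivity)
      _ ≤ (C * ((N : ℝ) + 1) ^ D) *
          (C' * ((N : ℝ) + 1) ^ (-D - 1) * (C'' * ((N : ℝ) + 1) ^ (1 / 2 : ℝ))) := by
          gcongr; exact hh N
      _ = C * C' * C'' * ((((N : ℝ) + 1) ^ D * ((N : ℝ) + 1) ^ (-D - 1)) *
            ((N : ℝ) + 1) ^ (1 / 2 : ℝ)) := by ring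
      _ = _ := by
          rw [← zpow_add₀ hp.ne', ← Real.rpow_intCast, ← Real.rpow_add hp]
          congr 2
          push_cast
          ring
  · have h1 : Tendsto (fun N : ℕ => (N : ℝ) + 1) atTop atTop :=
      tendsto_atTop_add_const_right _ _ tendsto_natCast_atTop_atTop
    simpa using ((tendsto_rpow_neg_atTop (y := 1 / 2) (by norm_num)).comp h1).const_mul
      (C * C' * C'')

lemma weak_absList_bounded (l : List Entry) (hne : l ≠ [])
    (hl : ∀ e ∈ l, Growth e.2 e.1) (hadm : Admissible 0 (l.map Prod.snd)) :
    ∃ C : ℝ, ∀ N : ℕ, weak (absList (l.map Prod.fst)) N ≤ C := by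
  obtain _ | ⟨⟨f, d⟩, l⟩ := l
  · exact absurd rfl hne
  obtain ⟨hd, hadm⟩ := hadm
  obtain ⟨C, hC, hf⟩ := hl _ List.mem_cons_self
  obtain ⟨C', hC', h⟩ := weak_absList_le l (fun e he => hl e (List.mem_cons_of_mem _ he)) hd hadm
  obtain ⟨C'', hC'', hh⟩ := harm_pow_le l.length
  have hs : Summable fun m : ℕ => C * C' * C'' * ((m : ℝ) + 1) ^ (-(3 / 2) : ℝ) := by
    refine Summable.mul_left _ ?_
    have := (summable_nat_add_iff 1).2
      (Real.summable_nat_rpow (p := -(3 / 2)) |>.2 (by norm_num))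
    simpa using this
  refine ⟨∑' m : ℕ, C * C' * C'' * ((m : ℝ) + 1) ^ (-(3 / 2) : ℝ), fun N => ?_⟩
  refine le_trans (sum_le_sum fun m _ => ?_) (hs.sum_le_tsum (range N) fun m _ => by positivity)
  have hp : (0 : ℝ) < (m : ℝ) + 1 := by positivity
  calc ‖f m‖ * weak (absList (l.map Prod.fst)) (m + 1)
      ≤ (C * ((m : ℝ) + 1) ^ d) *
        (C' * ((m : ℝ) + 1) ^ (-(0 + d + 1) - 1) * harm m ^ l.length) :=
        mul_le_mul (hf m) (h m) (weak_absList_nonneg _ _) (by positivity)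
    _ ≤ (C * ((m : ℝ) + 1) ^ d) *
        (C' * ((m : ℝ) + 1) ^ (-(0 + d + 1) - 1) * (C'' * ((m : ℝ) + 1) ^ (1 / 2 : ℝ))) := by
        gcongr; exact hh m
    _ = C * C' * C'' * ((((m : ℝ) + 1) ^ d * ((m : ℝ) + 1) ^ (-(0 + d + 1) - 1)) *
          ((m : ℝ) + 1) ^ (1 / 2 : ℝ)) := by ring
    _ = _ := by
        rw [← zpow_add₀ hp.ne', ← Real.rpow_intCast, ← Real.rpow_add hp]
        congr 2
        push_cast
        ring

lemma summable_and_tendsto_of_box {p : ℕ} (S : (Fin p → ℕ) → Prop) (φ : (Fin p → ℕ) → ℂ) {C : ℝ}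
    (h : ∀ N, ∑ k ∈ box p S N, ‖φ k‖ ≤ C) :
    Summable (fun k : {k : Fin p → ℕ // S k ∧ ∀ i, 1 ≤ k i} => φ k.1) ∧
    Tendsto (fun N => ∑ k ∈ box p S N, φ k) atTop
      (𝓝 (∑' k : {k : Fin p → ℕ // S k ∧ ∀ i, 1 ≤ k i}, φ k.1)) := by
  classical
  set B : ℕ → Finset {k : Fin p → ℕ // S k ∧ ∀ i, 1 ≤ k i} :=
    fun N => (box p S N).subtype _ with hB
  have hsum {M : Type} [AddCommMonoid M] (ψ : (Fin p → ℕ) → M) (N : ℕ) :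
      ∑ k ∈ B N, ψ k.1 = ∑ k ∈ box p S N, ψ k := by
    refine sum_subtype_of_mem ψ fun k hk => ?_
    rw [mem_box] at hk
    exact ⟨hk.2, fun i => (hk.1 i).1⟩
  have hmono : Monotone B := by
    intro N M hNM k hk
    simp only [hB, mem_subtype, mem_box] at hk ⊢
    exact ⟨fun i => ⟨(hk.1 i).1, (hk.1 i).2.trans hNM⟩, hk.2⟩
  have hcov (k : {k : Fin p → ℕ // S k ∧ ∀ i, 1 ≤ k i}) : ∃ N, k ∈ B N := by
    refine ⟨∑ i, k.1 i, ?_⟩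
    simp only [hB, mem_subtype, mem_box]
    exact ⟨fun i => ⟨k.2.2 i, single_le_sum (f := k.1) (fun _ _ => Nat.zero_le _) (mem_univ i)⟩,
      k.2.1⟩
  have htop : Tendsto B atTop atTop := tendsto_atTop_finset_of_monotone hmono hcov
  have hs : Summable (fun k : {k : Fin p → ℕ // S k ∧ ∀ i, 1 ≤ k i} => φ k.1) := by
    refine Summable.of_norm (summable_of_sum_le (c := C) (fun _ => norm_nonneg _) fun u => ?_)
    obtain ⟨N, hN⟩ := (htop.eventually (eventually_ge_atTop u)).exists
    refine (sum_le_sum_of_subset_of_nonneg hN fun _ _ _ => norm_nonneg _).trans ?_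
    rw [hsum (fun k => ‖φ k‖)]
    exact h N
  refine ⟨hs, ?_⟩
  simpa [Function.comp_def, hsum] using hs.hasSum.comp htop

lemma absList_ofFn {p : ℕ} (f : Fin p → ℕ → ℂ) :
    absList (List.ofFn f) = List.ofFn fun i m => ‖f i m‖ := by
  simp [absList, List.map_ofFn, Function.comp_def]

lemma ofFn_entry {p : ℕ} {f : Fin p → ℕ → ℂ} {d : Fin p → ℤ} (hp : 0 < p)
    (hf : ∀ i, Growth (d i) (f i)) (hd : Admissible 0 (List.ofFn d)) :
    ∃ C : ℝ, ∀ N, ∑ k ∈ box p Antitone N, ‖∏ i, f i (k i - 1)‖ ≤ C := by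
  obtain ⟨C, hC⟩ := weak_absList_bounded (List.ofFn fun i => (f i, d i))
    (by simpa [List.ofFn_eq_nil_iff] using hp.ne') (by simpa [List.mem_ofFn] using hf)
    (by simpa [List.map_ofFn, Function.comp_def] using hd)
  refine ⟨C, fun N => ?_⟩
  convert hC N using 1
  rw [List.map_ofFn, absList_ofFn, weak_ofFn]
  simp [norm_prod]

lemma summable_weak {p : ℕ} {f : Fin p → ℕ → ℂ} {d : Fin p → ℤ} (hp : 0 < p)
    (hf : ∀ i, Growth (d i) (f i)) (hd : Admissible 0 (List.ofFn d)) :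
    Summable (fun k : {k : Fin p → ℕ // Antitone k ∧ ∀ i, 1 ≤ k i} => ∏ i, f i (k.1 i - 1)) ∧
    Tendsto (weak (List.ofFn f)) atTop
      (𝓝 (∑' k : {k : Fin p → ℕ // Antitone k ∧ ∀ i, 1 ≤ k i}, ∏ i, f i (k.1 i - 1))) := by
  obtain ⟨C, hC⟩ := ofFn_entry hp hf hd
  simpa only [← weak_ofFn] using summable_and_tendsto_of_box Antitone
    (fun k => ∏ i, f i (k i - 1)) hC

lemma tendsto_strict {p : ℕ} {f : Fin p → ℕ → ℂ} {d : Fin p → ℤ} (hp : 0 < p)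
    (hf : ∀ i, Growth (d i) (f i)) (hd : Admissible 0 (List.ofFn d)) :
    Tendsto (strict (List.ofFn f)) atTop
      (𝓝 (∑' k : {k : Fin p → ℕ // StrictAnti k ∧ ∀ i, 1 ≤ k i}, ∏ i, f i (k.1 i - 1))) := by
  obtain ⟨C, hC⟩ := ofFn_entry hp hf hd
  have := (summable_and_tendsto_of_box StrictAnti (fun k => ∏ i, f i (k i - 1)) (C := C)
    fun N => (sum_le_sum_of_subset_of_nonneg (fun k hk => ?_) fun _ _ _ => norm_nonneg _).trans
      (hC N)).2
  · simpa only [← strict_ofFn] using this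
  · rw [mem_box] at hk ⊢
    exact ⟨hk.1, hk.2.antitone⟩

end Growth

section Rational

/-- The sequence `m ↦ 1 / (m + a + 1) ^ s`. -/
noncomputable def invPow (a s : ℕ) : ℕ → ℂ := fun m => (((m : ℂ) + a + 1) ^ s)⁻¹

lemma cast_add_ne_zero (m a : ℕ) : (m : ℂ) + a + 1 ≠ 0 := by exact_mod_cast (m + a).succ_ne_zero

lemma invPow_mul (a s t : ℕ) : invPow a s * invPow a t = invPow a (s + t) := by
  ext m
  simp [invPow, pow_add, mul_comm]

lemma invPow_zero (a : ℕ) : invPow a 0 = 1 := by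
  ext m
  simp [invPow]

lemma invPow_one_pow (a s : ℕ) : invPow a 1 ^ s = invPow a s := by
  ext m
  simp [invPow]

lemma growth_invPow (a s : ℕ) : Growth (-(s : ℤ)) (invPow a s) := by
  refine ⟨1, zero_le_one, fun m => ?_⟩
  have h : ‖(m : ℂ) + a + 1‖ = (m : ℝ) + a + 1 := by
    have : (m : ℂ) + a + 1 = ((m + a + 1 : ℕ) : ℂ) := by push_cast; ring
    rw [this, Complex.norm_natCast]
    push_cast
    ring
  rw [invPow, norm_inv, norm_pow, h, one_mul, zpow_neg, zpow_natCast]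
  gcongr
  linarith [Nat.cast_nonneg (α := ℝ) a]

variable (K : Subfield ℂ)

/-- The rational functions over `K` without pole at the negative integers, as sequences. -/
noncomputable def rat : Subalgebra K (ℕ → ℂ) :=
  Algebra.adjoin K ({fun m : ℕ => (m : ℂ)} ∪ Set.range fun a => invPow a 1)

/-- The polynomial functions over `K`, as sequences. -/
noncomputable def pol : Submodule K (ℕ → ℂ) :=
  Submodule.span K (Set.range fun (e : ℕ) (m : ℕ) => (m : ℂ) ^ e)

/-- The `K`-span of the inverses of the powers of `m + a + 1`. -/
noncomputable def frac : Submodule K (ℕ → ℂ) :=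
  Submodule.span K (Set.range fun x : ℕ × ℕ => invPow x.1 (x.2 + 1))

/-- The `K`-span of the inverses of the powers of `m + 1`. -/
noncomputable def powSpan : Submodule K (ℕ → ℂ) :=
  Submodule.span K (Set.range fun s : ℕ => invPow 0 (s + 1))

variable {K}

lemma smul_apply_eq (c : K) (f : ℕ → ℂ) (m : ℕ) : (c • f) m = (c : ℂ) * f m := rfl

lemma smul_eq_fun (c : K) (f : ℕ → ℂ) : c • f = fun m => (c : ℂ) * f m := rfl

lemma apply_mem_of_mem_rat {f : ℕ → ℂ} (hf : f ∈ rat K) (m : ℕ) : f m ∈ K := by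
  induction hf using Algebra.adjoin_induction with
  | mem f hf =>
    rcases hf with rfl | ⟨a, rfl⟩
    · exact natCast_mem K m
    · exact inv_mem (pow_mem (add_mem (add_mem (natCast_mem K m) (natCast_mem K a)) K.one_mem) 1)
  | algebraMap c => exact c.2
  | add f g _ _ hf hg => exact add_mem hf hg
  | mul f g _ _ hf hg => exact mul_mem hf hg

lemma id_mem_rat : (fun m : ℕ => (m : ℂ)) ∈ rat K :=
  Algebra.subset_adjoin (Or.inl rfl)

lemma invPow_mem_rat (a s : ℕ) : invPow a s ∈ rat K := by
  rw [← invPow_one_pow]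
  have h : invPow a 1 ∈ rat K := Algebra.subset_adjoin (Or.inr ⟨a, rfl⟩)
  exact pow_mem h s

lemma shift_mem_rat {f : ℕ → ℂ} (hf : f ∈ rat K) : (fun m => f (m + 1)) ∈ rat K := by
  induction hf using Algebra.adjoin_induction with
  | mem f hf =>
    rcases hf with rfl | ⟨a, rfl⟩
    · convert add_mem (id_mem_rat (K := K)) (one_mem _) using 1
      ext m
      simp
    · convert invPow_mem_rat (K := K) (a + 1) 1 using 1
      ext m
      simp only [invPow]
      push_cast
      congr 2
      ring
  | algebraMap c => exact (rat K).algebraMap_mem c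
  | add f g _ _ hf hg => exact add_mem hf hg
  | mul f g _ _ hf hg => exact mul_mem hf hg

lemma pol_le_rat : pol K ≤ Subalgebra.toSubmodule (rat K) := by
  refine Submodule.span_le.2 ?_
  rintro _ ⟨e, rfl⟩
  exact pow_mem (id_mem_rat (K := K)) e

lemma frac_le_rat : frac K ≤ Subalgebra.toSubmodule (rat K) := by
  refine Submodule.span_le.2 ?_
  rintro _ ⟨x, rfl⟩
  exact invPow_mem_rat _ _

lemma powSpan_le_frac : powSpan K ≤ frac K :=
  Submodule.span_mono (by rintro _ ⟨s, rfl⟩; exact ⟨(0, s), rfl⟩)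

lemma pow_mem_pol (e : ℕ) : (fun m : ℕ => (m : ℂ) ^ e) ∈ pol K :=
  Submodule.subset_span ⟨e, rfl⟩

lemma invPow_mem_frac (a s : ℕ) : invPow a (s + 1) ∈ frac K :=
  Submodule.subset_span ⟨(a, s), rfl⟩

lemma id_mul_mem {f : ℕ → ℂ} (hf : f ∈ pol K ⊔ frac K) :
    (fun m : ℕ => (m : ℂ)) * f ∈ pol K ⊔ frac K := by
  rw [pol, frac, ← Submodule.span_union] at hf ⊢
  induction hf using Submodule.span_induction with
  | mem f hf =>
    rw [Submodule.span_union, ← pol, ← frac]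
    rcases hf with ⟨e, rfl⟩ | ⟨⟨a, s⟩, rfl⟩
    · refine Submodule.mem_sup_left ?_
      convert pow_mem_pol (K := K) (e + 1) using 1
      ext m
      simp [pow_succ']
    · have h : (fun m : ℕ => (m : ℂ)) * invPow a (s + 1) =
          invPow a s - ((a : K) + 1) • invPow a (s + 1) := by
        ext m
        have := cast_add_ne_zero m a
        simp only [Pi.mul_apply, Pi.sub_apply, smul_apply_eq, invPow]
        push_cast
        field_simp
        ring
      simp only [h]
      refine sub_mem ?_ (Submodule.smul_mem _ _ (Submodule.mem_sup_right (invPow_mem_frac a s)))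
      cases s with
      | zero =>
        refine Submodule.mem_sup_left ?_
        convert pow_mem_pol (K := K) 0 using 1
        ext m
        simp [invPow]
      | succ s => exact Submodule.mem_sup_right (invPow_mem_frac a s)
  | zero => simp
  | add f g _ _ hf hg => rw [mul_add]; exact add_mem hf hg
  | smul c f _ hf => rw [mul_smul_comm]; exact Submodule.smul_mem _ c hf

lemma invPow_one_mul_mem (a : ℕ) {f : ℕ → ℂ} (hf : f ∈ pol K ⊔ frac K) :
    invPow a 1 * f ∈ pol K ⊔ frac K := by
  rw [pol, frac, ← Submodule.span_union] at hf ⊢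
  induction hf using Submodule.span_induction with
  | mem f hf =>
    rw [Submodule.span_union, ← pol, ← frac]
    rcases hf with ⟨e, rfl⟩ | ⟨⟨b, s⟩, rfl⟩
    · induction e with
      | zero =>
        convert Submodule.mem_sup_right (S := pol K) (invPow_mem_frac (K := K) a 0) using 1
        ext m
        simp
      | succ e ih =>
        have h : (invPow a 1 * fun m : ℕ => (m : ℂ) ^ (e + 1)) =
            (fun m : ℕ => (m : ℂ)) * (invPow a 1 * fun m : ℕ => (m : ℂ) ^ e) := by
          ext m
          simp only [Pi.mul_apply]
          ring
        simp only [h]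
        exact id_mul_mem ih
    · by_cases hab : a = b
      · subst hab
        simp only [invPow_mul]
        rw [add_comm]
        exact Submodule.mem_sup_right (invPow_mem_frac a (s + 1))
      · have hab' : ((b : K) - a) ≠ 0 := sub_ne_zero.2 (by exact_mod_cast Ne.symm hab)
        have hab'' : ((b : ℂ) - a) ≠ 0 := sub_ne_zero.2 (by exact_mod_cast Ne.symm hab)
        have key (t : ℕ) : invPow a 1 * invPow b (t + 1) =
            ((b : K) - a)⁻¹ • (invPow a 1 * invPow b t - invPow b (t + 1)) := by
          ext m
          have := cast_add_ne_zero m a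
          have := cast_add_ne_zero m b
          simp only [Pi.mul_apply, Pi.sub_apply, smul_apply_eq, invPow]
          push_cast
          field_simp
          ring
        suffices h : ∀ t, invPow a 1 * invPow b t ∈ pol K ⊔ frac K from h (s + 1)
        intro t
        induction t with
        | zero =>
          rw [invPow_zero, mul_one]
          exact Submodule.mem_sup_right (invPow_mem_frac a 0)
        | succ t ih =>
          rw [key]
          exact Submodule.smul_mem _ _
            (sub_mem ih (Submodule.mem_sup_right (invPow_mem_frac b t)))
  | zero => simp
  | add f g _ _ hf hg => rw [mul_add]; exact add_mem hf hg
  | smul c f _ hf => rw [mul_smul_comm]; exact Submodule.smul_mem _ c hf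

lemma rat_le : Subalgebra.toSubmodule (rat K) ≤ pol K ⊔ frac K := by
  intro f hf
  suffices h : ∀ g ∈ pol K ⊔ frac K, f * g ∈ pol K ⊔ frac K by
    rw [← mul_one f]
    refine h 1 (Submodule.mem_sup_left ?_)
    convert pow_mem_pol (K := K) 0 using 1
    ext m
    simp
  change f ∈ rat K at hf
  induction hf using Algebra.adjoin_induction with
  | mem f hf =>
    intro g hg
    rcases hf with rfl | ⟨a, rfl⟩
    · exact id_mul_mem hg
    · exact invPow_one_mul_mem a hg
  | algebraMap c =>
    intro g hg
    rw [← Algebra.smul_def]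
    exact Submodule.smul_mem _ c hg
  | add f f' _ _ hf hf' =>
    intro g hg
    rw [add_mul]
    exact add_mem (hf g hg) (hf' g hg)
  | mul f f' _ _ hf hf' =>
    intro g hg
    rw [mul_assoc]
    exact hf _ (hf' g hg)

lemma growth_of_mem_frac {f : ℕ → ℂ} (hf : f ∈ frac K) : Growth (-1) f := by
  induction hf using Submodule.span_induction with
  | mem f hf =>
    obtain ⟨⟨a, s⟩, rfl⟩ := hf
    exact (growth_invPow a (s + 1)).mono (by push_cast; omega)
  | zero => exact Growth.zero _
  | add f g _ _ hf hg => exact hf.add hg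
  | smul c f _ hf => exact hf.const_mul c

lemma diff_add (f g : ℕ → ℂ) : diff (f + g) = diff f + diff g := by
  ext m
  simp only [diff, Pi.add_apply]
  ring

lemma diff_smul (c : K) (f : ℕ → ℂ) : diff (c • f) = c • diff f := by
  ext m
  simp only [diff, smul_apply_eq]
  ring

lemma growth_diff_invPow (a s : ℕ) : Growth (-2) (diff (invPow a s)) := by
  induction s with
  | zero =>
    rw [invPow_zero]
    convert Growth.zero (-2) using 1
    ext m
    simp [diff]
  | succ s ih =>
    have h1 : diff (invPow a 1) = fun m => (-1 : ℂ) * (invPow a 1 * invPow (a + 1) 1) m := by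
      ext m
      have h := cast_add_ne_zero m a
      have h' := cast_add_ne_zero m (a + 1)
      push_cast at h'
      have h'' : (m : ℂ) + 1 + a + 1 ≠ 0 := by rwa [add_right_comm (m : ℂ), add_assoc (m : ℂ)]
      simp only [diff, invPow, Pi.mul_apply]
      push_cast
      field_simp
      ring
    have h2 : diff (invPow a (s + 1)) =
        (fun m => invPow a 1 (m + 1)) * diff (invPow a s) + diff (invPow a 1) * invPow a s := by
      ext m
      rw [add_comm s, ← invPow_mul]
      simp only [diff, Pi.mul_apply, Pi.add_apply]
      ring
    rw [h2]
    refine Growth.add (((growth_invPow a 1).shift.mul ih).mono (by norm_num)) ?_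
    rw [h1]
    exact ((((growth_invPow a 1).mul (growth_invPow (a + 1) 1)).const_mul (-1)).mul
      (growth_invPow a s)).mono (by push_cast; omega)

lemma growth_diff_of_mem_frac {f : ℕ → ℂ} (hf : f ∈ frac K) : Growth (-2) (diff f) := by
  induction hf using Submodule.span_induction with
  | mem f hf =>
    obtain ⟨⟨a, s⟩, rfl⟩ := hf
    exact growth_diff_invPow a _
  | zero =>
    convert Growth.zero (-2) using 1
    ext m
    simp [diff]
  | add f g _ _ hf hg => rw [diff_add]; exact hf.add hg
  | smul c f _ hf => rw [diff_smul]; exact hf.const_mul c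

lemma exists_polynomial_of_mem_pol {f : ℕ → ℂ} (hf : f ∈ pol K) :
    ∃ q : Polynomial ℂ, ∀ m : ℕ, f m = q.eval (m : ℂ) := by
  induction hf using Submodule.span_induction with
  | mem f hf =>
    obtain ⟨e, rfl⟩ := hf
    exact ⟨Polynomial.X ^ e, by simp⟩
  | zero => exact ⟨0, by simp⟩
  | add f g _ _ hf hg =>
    obtain ⟨q, hq⟩ := hf
    obtain ⟨q', hq'⟩ := hg
    exact ⟨q + q', by simp [hq, hq']⟩
  | smul c f _ hf =>
    obtain ⟨q, hq⟩ := hf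
    exact ⟨Polynomial.C (c : ℂ) * q, fun m => by rw [smul_apply_eq, hq]; simp⟩

lemma eq_zero_of_mem_pol {f : ℕ → ℂ} (hf : f ∈ pol K) (hg : Growth (-1) f) : f = 0 := by
  obtain ⟨q, hq⟩ := exists_polynomial_of_mem_pol hf
  have h0 := hg.tendsto_zero
  have hdeg : q.degree ≤ 0 := by
    by_contra! hd
    have h1 : Tendsto (fun m : ℕ => ‖q.eval (m : ℂ)‖) atTop atTop :=
      q.tendsto_norm_atTop hd (by simpa using tendsto_natCast_atTop_atTop (R := ℝ))
    exact not_tendsto_nhds_of_tendsto_atTop h1 0 (by simpa [hq] using h0.norm)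
  have hc : f = fun _ => q.coeff 0 := by
    ext m
    rw [hq, Polynomial.eq_C_of_degree_le_zero hdeg]
    simp
  rw [hc] at h0 ⊢
  have := tendsto_nhds_unique h0 tendsto_const_nhds
  rw [← this]
  rfl

lemma sum_range_mem_pol {f : ℕ → ℂ} (hf : f ∈ pol K) :
    (fun m => ∑ j ∈ range m, f j) ∈ pol K := by
  induction hf using Submodule.span_induction with
  | mem f hf =>
    obtain ⟨e, rfl⟩ := hf
    have h : (fun m : ℕ => ∑ j ∈ range m, (j : ℂ) ^ e) = ∑ i ∈ range (e + 1),
        ((bernoulli i * ((e + 1).choose i) / (e + 1) : ℚ) : K) •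
          fun m : ℕ => (m : ℂ) ^ (e + 1 - i) := by
      ext m
      have := congrArg (fun x : ℚ => (x : ℂ)) (sum_range_pow m e)
      push_cast at this
      rw [this, Finset.sum_apply]
      refine sum_congr rfl fun i _ => ?_
      rw [smul_apply_eq]
      push_cast
      ring
    simp only [h]
    exact Submodule.sum_mem _ fun i _ => Submodule.smul_mem _ _ (pow_mem_pol _)
  | zero =>
    convert zero_mem (pol K) using 1
    ext m
    simp
  | add f g _ _ hf hg =>
    convert add_mem hf hg using 1
    ext m
    simp [sum_add_distrib]
  | smul c f _ hf =>
    convert Submodule.smul_mem _ c hf using 1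
    ext m
    simp only [smul_apply_eq, mul_sum]

lemma invPow_eq_add_diff (a s : ℕ) :
    invPow a s = invPow 0 s + diff (∑ b ∈ range a, invPow b s) := by
  induction a with
  | zero => ext m; simp [diff]
  | succ a ih =>
    rw [sum_range_succ, diff_add, ← add_assoc, ← ih]
    ext m
    simp only [diff, Pi.add_apply, invPow]
    push_cast
    ring

lemma exists_powSpan_of_mem_frac {f : ℕ → ℂ} (hf : f ∈ frac K) :
    ∃ g ∈ powSpan K, ∃ G ∈ frac K, f = g + diff G := by
  induction hf using Submodule.span_induction with
  | mem f hf =>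
    obtain ⟨⟨a, s⟩, rfl⟩ := hf
    exact ⟨invPow 0 (s + 1), Submodule.subset_span ⟨s, rfl⟩, _,
      Submodule.sum_mem _ fun b _ => invPow_mem_frac b s, invPow_eq_add_diff a (s + 1)⟩
  | zero => exact ⟨0, zero_mem _, 0, zero_mem _, by ext m; simp [diff]⟩
  | add f g _ _ hf hg =>
    obtain ⟨f', hf', F, hF, rfl⟩ := hf
    obtain ⟨g', hg', G, hG, rfl⟩ := hg
    exact ⟨f' + g', add_mem hf' hg', F + G, add_mem hF hG, by rw [diff_add]; abel⟩
  | smul c f _ hf =>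
    obtain ⟨f', hf', F, hF, rfl⟩ := hf
    exact ⟨c • f', Submodule.smul_mem _ c hf', c • F, Submodule.smul_mem _ c hF,
      by rw [diff_smul, smul_add]⟩

variable (K) in
/-- `g` represents `f` modulo polynomials and differences. -/
def Represents (f g : ℕ → ℂ) : Prop :=
  g ∈ powSpan K ∧ ∃ Q ∈ pol K, ∃ G ∈ frac K, f = Q + (g + diff G)

lemma exists_represents {f : ℕ → ℂ} (hf : f ∈ rat K) : ∃ g, Represents K f g := by
  obtain ⟨Q, hQ, F, hF, rfl⟩ := Submodule.mem_sup.1 (rat_le hf)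
  obtain ⟨g, hg, G, hG, rfl⟩ := exists_powSpan_of_mem_frac hF
  exact ⟨g, hg, Q, hQ, G, hG, rfl⟩

lemma growth_of_represents {f g : ℕ → ℂ} (h : Represents K f g) (hf : Growth (-2) f) :
    Growth (-2) g := by
  obtain ⟨hg, Q, hQ, G, hG, rfl⟩ := h
  have h1 := growth_of_mem_frac (powSpan_le_frac hg)
  have h2 := growth_diff_of_mem_frac hG
  have h3 : Growth (-1) Q := by
    have := (hf.mono (by norm_num : (-2 : ℤ) ≤ -1)).sub (h1.add (h2.mono (by norm_num)))
    rwa [add_sub_cancel_right] at this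
  rw [eq_zero_of_mem_pol hQ h3, zero_add] at hf
  have := hf.sub h2
  rwa [add_sub_cancel_right] at this

lemma eq_zero_of_growth_smul {c : ℂ} (h : Growth (-2) fun m => c * invPow 0 1 m) : c = 0 := by
  have h1 : Growth 1 fun m : ℕ => (m : ℂ) + 1 :=
    ⟨1, zero_le_one, fun m => by
      rw [zpow_one, one_mul]
      exact (norm_add_le _ _).trans (by simp)⟩
  have h2 := (h1.mul h).tendsto_zero
  have h3 : ((fun m : ℕ => (m : ℂ) + 1) * fun m => c * invPow 0 1 m) = fun _ => c := by
    ext m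
    have : (m : ℂ) + 1 ≠ 0 := by exact_mod_cast m.succ_ne_zero
    simp only [Pi.mul_apply, invPow]
    push_cast
    field_simp
    ring
  rw [h3] at h2
  exact tendsto_nhds_unique tendsto_const_nhds h2

lemma mem_span_of_growth {g : ℕ → ℂ} (hg : g ∈ powSpan K) (h : Growth (-2) g) :
    g ∈ Submodule.span K (Set.range fun s : ℕ => invPow 0 (s + 2)) := by
  have hsub : powSpan K ≤ Submodule.span K {invPow 0 1} ⊔
      Submodule.span K (Set.range fun s : ℕ => invPow 0 (s + 2)) := by
    refine Submodule.span_le.2 ?_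
    rintro _ ⟨_ | s, rfl⟩
    · exact Submodule.mem_sup_left (Submodule.mem_span_singleton_self _)
    · exact Submodule.mem_sup_right (Submodule.subset_span ⟨s, rfl⟩)
  obtain ⟨a, ha, b, hb, rfl⟩ := Submodule.mem_sup.1 (hsub hg)
  obtain ⟨c, rfl⟩ := Submodule.mem_span_singleton.1 ha
  have hb2 : Growth (-2) b := by
    clear hg h
    induction hb using Submodule.span_induction with
    | mem f hf =>
      obtain ⟨s, rfl⟩ := hf
      exact (growth_invPow 0 (s + 2)).mono (by push_cast; omega)
    | zero => exact Growth.zero _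
    | add f g _ _ hf hg => exact hf.add hg
    | smul c f _ hf => exact hf.const_mul c
  have h0 := h.sub hb2
  rw [add_sub_cancel_right, smul_eq_fun] at h0
  have hc : c = 0 := by exact_mod_cast eq_zero_of_growth_smul h0
  rw [hc, zero_smul, zero_add]
  exact hb

end Rational

section Depth

variable (K : Subfield ℂ)

/-- The `K`-span of the convergent multiple zeta values of depth less than `q`. -/
noncomputable def mzvSpan (q : ℕ) : Submodule K ℂ :=
  Submodule.span K ((fun s : List ℕ => (mzv s : ℂ)) ''
    {s | s.length < q ∧ (∀ a ∈ s, 1 ≤ a) ∧ (s ≠ [] → 2 ≤ s.headI)})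

variable {K}

lemma mzvSpan_mono {q q' : ℕ} (h : q ≤ q') : mzvSpan K q ≤ mzvSpan K q' :=
  Submodule.span_mono (Set.image_mono fun _ hs => ⟨hs.1.trans_le h, hs.2⟩)

lemma mzv_mem_mzvSpan {q : ℕ} {s : List ℕ} (hs : s.length < q) (h1 : ∀ a ∈ s, 1 ≤ a)
    (h2 : s ≠ [] → 2 ≤ s.headI) : (mzv s : ℂ) ∈ mzvSpan K q :=
  Submodule.subset_span ⟨s, ⟨hs, h1, h2⟩, rfl⟩

lemma mzv_nil : mzv [] = 1 := by
  have : Unique {k : Fin ([] : List ℕ).length → ℕ // StrictAnti k ∧ ∀ i, 1 ≤ k i} :=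
    { default := ⟨fun i => i.elim0, fun i => i.elim0, fun i => i.elim0⟩
      uniq := fun k => Subtype.ext (funext fun i => i.elim0) }
  rw [mzv, tsum_eq_single default fun k hk => absurd (Unique.eq_default k) hk]
  rfl

lemma one_mem_mzvSpan {q : ℕ} (hq : 0 < q) : (1 : ℂ) ∈ mzvSpan K q := by
  have h : (mzv [] : ℂ) ∈ mzvSpan K q := mzv_mem_mzvSpan (by simpa) (by simp) (by simp)
  simpa [mzv_nil] using h

/-- The sequence `u` converges to an element of `M`. -/
def LimIn (M : Submodule K ℂ) (u : ℕ → ℂ) : Prop := ∃ x ∈ M, Tendsto u atTop (𝓝 x)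

namespace LimIn

variable {M M' : Submodule K ℂ} {u v : ℕ → ℂ}

lemma mono (h : LimIn M u) (hM : M ≤ M') : LimIn M' u :=
  let ⟨x, hx, hu⟩ := h
  ⟨x, hM hx, hu⟩

lemma zero : LimIn M fun _ => 0 := ⟨0, zero_mem _, tendsto_const_nhds⟩

lemma add (hu : LimIn M u) (hv : LimIn M v) : LimIn M fun N => u N + v N :=
  let ⟨x, hx, hu⟩ := hu
  let ⟨y, hy, hv⟩ := hv
  ⟨x + y, add_mem hx hy, hu.add hv⟩

lemma const_mul (hu : LimIn M u) {c : ℂ} (hc : c ∈ K) : LimIn M fun N => c * u N :=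
  let ⟨x, hx, hu⟩ := hu
  ⟨c * x, M.smul_mem ⟨c, hc⟩ hx, hu.const_mul c⟩

lemma sum {ι : Type*} {s : Finset ι} {u : ι → ℕ → ℂ} (h : ∀ i ∈ s, LimIn M (u i)) :
    LimIn M fun N => ∑ i ∈ s, u i N := by
  choose! x hx hu using h
  exact ⟨∑ i ∈ s, x i, Submodule.sum_mem _ hx, tendsto_finsetSum _ hu⟩

end LimIn

/-- A sequence in `rat K` together with a bound for its growth. -/
def Good (K : Subfield ℂ) (e : Entry) : Prop := e.1 ∈ rat K ∧ Growth e.2 e.1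

/-- Convergent nested sums of length `p` of sequences in `rat K` converge to combinations
of multiple zeta values of depth at most `p`. -/
def Expressible (K : Subfield ℂ) (p : ℕ) : Prop :=
  ∀ l : List Entry, l.length = p → (∀ e ∈ l, Good K e) → Admissible 0 (l.map Prod.snd) →
    LimIn (mzvSpan K (p + 1)) (weak (l.map Prod.fst))

lemma Good.left_mul {G : ℕ → ℂ} {d : ℤ} (hG : G ∈ rat K) (hGd : Growth (d + 1) G) {e : Entry}
    (he : Good K e) : Good K (G * e.1, d + 1 + e.2) :=
  ⟨mul_mem hG he.1, hGd.mul he.2⟩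

lemma limIn_weak_append_diff {p : ℕ} (hC : Expressible K p) (pre post : List Entry)
    (hlen : pre.length + post.length = p) (hpre : ∀ e ∈ pre, Good K e)
    (hpost : ∀ e ∈ post, Good K e) {G : ℕ → ℂ} {d : ℤ} (hG : G ∈ rat K)
    (hGd : Growth (d + 1) G)
    (hadm : Admissible 0 (pre.map Prod.snd ++ d :: post.map Prod.snd)) :
    LimIn (mzvSpan K (p + 1)) (weak (pre.map Prod.fst ++ diff G :: post.map Prod.fst)) := by
  rcases List.eq_nil_or_concat pre with rfl | ⟨init, ⟨u, du⟩, rfl⟩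
  · obtain ⟨h1, h2⟩ := hadm
    rcases post with _ | ⟨e, post⟩
    · have h3 : weak (diff G :: []) = fun N => G N + (-G 0) * 1 := by
        ext N
        rw [weak_diff_singleton]
        ring
      have h4 : LimIn (mzvSpan K (p + 1)) fun _ => (1 : ℂ) :=
        ⟨1, one_mem_mzvSpan p.succ_pos, tendsto_const_nhds⟩
      simp only [List.map_nil, List.nil_append, h3]
      exact LimIn.add ⟨0, zero_mem _, (hGd.mono (by omega)).tendsto_zero⟩
        (h4.const_mul (neg_mem (apply_mem_of_mem_rat hG 0)))
    · have h3 : weak (diff G :: e.1 :: post.map Prod.fst) = fun N =>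
          G N * weak ((e :: post).map Prod.fst) N +
            (-1) * weak (((G * e.1, d + 1 + e.2) :: post : List Entry).map Prod.fst) N := by
        ext N
        rw [weak_diff_cons_cons]
        simp only [List.map_cons]
        ring
      simp only [List.map_nil, List.map_cons, List.nil_append, h3]
      refine LimIn.add ⟨0, zero_mem _, ?_⟩ (LimIn.const_mul ?_ (neg_mem (one_mem K)))
      · exact tendsto_mul_weak G (by omega) hGd (e :: post) (fun e he => (hpost e he).2)
          (by simpa using h2)
      · refine hC ((G * e.1, d + 1 + e.2) :: post) (by simpa using hlen) ?_ ?_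
        · simp only [List.mem_cons, forall_eq_or_imp] at hpost ⊢
          exact ⟨hpost.1.left_mul hG hGd, hpost.2⟩
        · obtain ⟨h4, h5⟩ := h2
          refine ⟨by simp only; omega, ?_⟩
          convert h5 using 1
          simp only
          ring
  · have hu : Good K (u, du) := hpre _ (by simp)
    have hinit : ∀ e ∈ init, Good K e := fun e he => hpre e (by simp [he])
    have hu' : Good K (u * fun m => G (m + 1), du + (d + 1)) :=
      ⟨mul_mem hu.1 (shift_mem_rat hG), hu.2.mul hGd.shift⟩
    rcases post with _ | ⟨e, post⟩
    · have h3 : weak ((init.concat (u, du)).map Prod.fst ++ diff G :: []) = fun N =>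
          weak ((init ++ [(u * fun m => G (m + 1), du + (d + 1))]).map Prod.fst) N +
            (-G 0) * weak ((init ++ [(u, du)]).map Prod.fst) N := by
        ext N
        simpa using weak_append_congr (weak_cons_diff_singleton u G) (init.map Prod.fst) N
      simp only [List.map_nil, h3]
      simp only [List.concat_eq_append, List.map_append, List.map_cons, List.map_nil,
        List.append_assoc, List.singleton_append] at hadm
      refine LimIn.add ?_ (LimIn.const_mul ?_ (neg_mem (apply_mem_of_mem_rat hG 0)))
      · refine hC _ (by simpa using hlen) ?_ ?_
        · simpa [or_imp, forall_and] using ⟨fun a b h => hinit (a, b) h, hu'⟩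
        · rw [List.map_append]
          refine Admissible.append_congr ?_ _ _ hadm
          rintro D ⟨h4, h5, -⟩
          exact ⟨by simp only; omega, trivial⟩
      · refine hC _ (by simpa using hlen) ?_ ?_
        · simpa [or_imp, forall_and] using ⟨fun a b h => hinit (a, b) h, hu⟩
        · rw [List.map_append]
          refine Admissible.append_congr ?_ _ _ hadm
          rintro D ⟨h4, h5, -⟩
          exact ⟨by simp only; omega, trivial⟩
    · have h3 : weak ((init.concat (u, du)).map Prod.fst ++ diff G :: (e :: post).map Prod.fst) =
          fun N => weak ((init ++ (u * fun m => G (m + 1), du + (d + 1)) :: e :: post).map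
            Prod.fst) N + (-1) * weak ((init ++ (u, du) :: (G * e.1, d + 1 + e.2) :: post).map
            Prod.fst) N := by
        ext N
        simpa using weak_append_congr (weak_cons_diff_cons_cons u G e.1 (post.map Prod.fst))
          (init.map Prod.fst) N
      rw [h3]
      simp only [List.concat_eq_append, List.map_append, List.map_cons, List.map_nil,
        List.append_assoc, List.singleton_append] at hadm
      simp only [List.mem_cons, forall_eq_or_imp] at hpost
      simp only [List.length_concat, List.length_cons] at hlen
      refine LimIn.add ?_ (LimIn.const_mul ?_ (neg_mem (one_mem K)))
      · refine hC _ (by simp; omega) ?_ ?_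
        · simp only [List.mem_append, List.mem_cons]
          rintro x (h | rfl | rfl | h)
          exacts [hinit x h, hu', hpost.1, hpost.2 x h]
        · rw [List.map_append]
          refine Admissible.append_congr ?_ _ _ hadm
          rintro D ⟨h4, h5, h6⟩
          refine ⟨by simp only; omega, ?_⟩
          convert h6 using 1
          · ring
          · rfl
      · refine hC _ (by simp; omega) ?_ ?_
        · simp only [List.mem_append, List.mem_cons]
          rintro x (h | rfl | rfl | h)
          exacts [hinit x h, hu, hpost.1.left_mul hG hGd, hpost.2 x h]
        · rw [List.map_append]
          refine Admissible.append_congr ?_ _ _ hadm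
          rintro D ⟨h4, h5, h6, h7⟩
          refine ⟨h4, by simp only; omega, ?_⟩
          convert h7 using 1
          simp only
          ring

lemma limIn_weak_append_sub {p : ℕ} (hC : Expressible K p)
    (l : List ((ℕ → ℂ) × (ℕ → ℂ) × ℤ)) (pre : List Entry)
    (hlen : pre.length + l.length = p + 1) (hpre : ∀ e ∈ pre, Good K e)
    (hl : ∀ x ∈ l, Good K (x.1, x.2.2) ∧ Good K x.2 ∧
      ∃ G ∈ rat K, Growth (x.2.2 + 1) G ∧ x.1 = x.2.1 + diff G)
    (hadm : Admissible 0 (pre.map Prod.snd ++ l.map fun x => x.2.2)) :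
    LimIn (mzvSpan K (p + 1)) fun N => weak (pre.map Prod.fst ++ l.map Prod.fst) N -
      weak (pre.map Prod.fst ++ l.map fun x => x.2.1) N := by
  induction l generalizing pre with
  | nil => simpa using LimIn.zero
  | cons x l ih =>
    obtain ⟨f, f', d⟩ := x
    simp only [List.mem_cons, forall_eq_or_imp] at hl
    obtain ⟨⟨-, hf', G, hG, hGd, hfG⟩, hl⟩ := hl
    have h1 := limIn_weak_append_diff hC pre (l.map fun x => (x.1, x.2.2))
      (by simp at hlen ⊢; omega) hpre (by
        simp only [List.mem_map]
        rintro _ ⟨x, hx, rfl⟩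
        exact (hl x hx).1) hG hGd (by simpa [Function.comp_def] using hadm)
    have h2 := ih (pre ++ [(f', d)]) (by simp at hlen ⊢; omega) (by
      simp only [List.mem_append, List.mem_singleton]
      rintro e (h | rfl)
      exacts [hpre e h, hf']) hl (by simpa using hadm)
    refine (congrArg _ (funext fun N => ?_)).mp (h1.add h2)
    have h3 := weak_append_congr (weak_cons_add f' (diff G) (l.map Prod.fst)) (pre.map Prod.fst) N
    rw [← hfG] at h3
    simp only [List.map_cons, List.map_append, List.map_nil, List.append_assoc,
      List.singleton_append, List.map_map, Function.comp_def] at h3 ⊢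
    rw [h3]
    ring

lemma exists_middle {f g : ℕ → ℂ} {d : ℤ} (h : Represents K f g) (hf : Growth d f) :
    ∃ F, Good K (F, d) ∧ (∃ G ∈ rat K, Growth (d + 1) G ∧ f = F + diff G) ∧
      ∃ G ∈ frac K, F = g + diff G := by
  obtain ⟨hg, Q, hQ, G, hG, rfl⟩ := h
  have h1 : Growth (-1) (g + diff G) := (growth_of_mem_frac (powSpan_le_frac hg)).add
    ((growth_diff_of_mem_frac hG).mono (by norm_num))
  have hrat : g + diff G ∈ rat K := add_mem (frac_le_rat (powSpan_le_frac hg))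
    (sub_mem (shift_mem_rat (frac_le_rat hG)) (frac_le_rat hG))
  refine ⟨g + diff G, ⟨hrat, ?_⟩, ?_, G, hG, rfl⟩
  · rcases le_or_gt 0 d with hd | hd
    · exact h1.mono (by simp only; omega)
    · have h2 := (hf.mono (by omega : d ≤ -1)).sub h1
      rw [add_sub_cancel_right] at h2
      rwa [eq_zero_of_mem_pol hQ h2, zero_add] at hf
  · rcases le_or_gt 0 d with hd | hd
    · have h2 := hf.sub (h1.mono (by omega : -1 ≤ d))
      rw [add_sub_cancel_right] at h2
      refine ⟨fun m => ∑ j ∈ range m, Q j, pol_le_rat (sum_range_mem_pol hQ),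
        h2.sum_range hd, ?_⟩
      rw [add_comm]
      congr 1
      ext m
      simp [diff, sum_range_succ]
    · have h2 := (hf.mono (by omega : d ≤ -1)).sub h1
      rw [add_sub_cancel_right] at h2
      refine ⟨0, zero_mem _, Growth.zero _, ?_⟩
      rw [eq_zero_of_mem_pol hQ h2]
      ext m
      simp [diff]

lemma admissible_neg_one {α : Type*} (l : List α) {D : ℤ} (hD : D ≤ -1) :
    Admissible D (l.map fun _ => -1) := by
  induction l generalizing D with
  | nil => trivial
  | cons a l ih =>
    have h : D + -1 + 1 ≤ -1 := by omega
    exact ⟨h, ih h⟩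

lemma limIn_weak_sub_represents {p : ℕ} (hC : Expressible K p)
    (l : List ((ℕ → ℂ) × (ℕ → ℂ) × ℤ)) (hlen : l.length = p + 1)
    (hl : ∀ x ∈ l, Good K (x.1, x.2.2) ∧ Represents K x.1 x.2.1)
    (hadm : Admissible 0 (l.map fun x => x.2.2)) :
    LimIn (mzvSpan K (p + 1)) fun N => weak (l.map Prod.fst) N -
      weak (l.map fun x => x.2.1) N := by
  have key (x : (ℕ → ℂ) × (ℕ → ℂ) × ℤ) : ∃ F, x ∈ l → Good K (F, x.2.2) ∧
      (∃ G ∈ rat K, Growth (x.2.2 + 1) G ∧ x.1 = F + diff G) ∧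
        ∃ G ∈ frac K, F = x.2.1 + diff G := by
    by_cases hx : x ∈ l
    · obtain ⟨F, hF⟩ := exists_middle (hl x hx).2 (hl x hx).1.2
      exact ⟨F, fun _ => hF⟩
    · exact ⟨0, fun h => absurd h hx⟩
  choose F hF using key
  have h1 := limIn_weak_append_sub hC (l.map fun x => (x.1, F x, x.2.2)) [] (by simpa using hlen)
    (by simp) (by
      simp only [List.mem_map]
      rintro _ ⟨x, hx, rfl⟩
      exact ⟨(hl x hx).1, (hF x hx).1, (hF x hx).2.1⟩) (by simpa [Function.comp_def] using hadm)
  have hgood {x} (hx : x ∈ l) {e : ℤ} (he : -1 ≤ e) : Good K (F x, e) ∧ Good K (x.2.1, e) ∧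
      ∃ G ∈ rat K, Growth (e + 1) G ∧ F x = x.2.1 + diff G := by
    obtain ⟨hFx, -, G, hG, hFG⟩ := hF x hx
    have hg := powSpan_le_frac (hl x hx).2.1
    have h2 := growth_of_mem_frac hg
    refine ⟨⟨hFx.1, ?_⟩, ⟨frac_le_rat hg, h2.mono he⟩, G, frac_le_rat hG,
      (growth_of_mem_frac hG).mono (by omega), hFG⟩
    simp only [hFG]
    exact (h2.mono he).add ((growth_diff_of_mem_frac hG).mono (by omega))
  have h2 : LimIn (mzvSpan K (p + 1)) fun N => weak (l.map F) N -
      weak (l.map fun x => x.2.1) N := by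
    rcases l with _ | ⟨x, l⟩
    · simp at hlen
    have hx := (hF x List.mem_cons_self)
    obtain ⟨hFx, -, G, hG, hFG⟩ := hx
    have hd : x.2.2 ≤ -2 := by
      have := hadm.1
      simp only at this
      omega
    have hF2 := hFx.2.mono hd
    have hg2 : Growth (-2) x.2.1 := growth_of_represents (hl x List.mem_cons_self).2
      ((hl x List.mem_cons_self).1.2.mono hd)
    have := limIn_weak_append_sub hC ((F x, x.2.1, -2) :: l.map fun x => (F x, x.2.1, -1)) []
      (by simpa using hlen) (by simp) (by
        simp only [List.mem_cons, List.mem_map]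
        rintro _ (rfl | ⟨y, hy, rfl⟩)
        · exact ⟨⟨hFx.1, hF2⟩,
            ⟨frac_le_rat (powSpan_le_frac (hl x List.mem_cons_self).2.1), hg2⟩, G,
            frac_le_rat hG, growth_of_mem_frac hG, hFG⟩
        · exact hgood (List.mem_cons_of_mem _ hy) le_rfl)
      ⟨by norm_num, by simpa [Function.comp_def] using admissible_neg_one l (by norm_num)⟩
    simpa [Function.comp_def] using this
  refine (congrArg _ (funext fun N => ?_)).mp (h1.add h2)
  simp [Function.comp_def]

lemma weak_eq_strict_add (l : List ℕ) (hl : ∀ a ∈ l, 1 ≤ a) :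
    ∃ L : List (List ℕ), (∀ m ∈ L, m.length < l.length ∧ (∀ a ∈ m, 1 ≤ a) ∧
        l.headI ≤ m.headI) ∧
      ∀ N, weak (l.map (invPow 0)) N =
        strict (l.map (invPow 0)) N + (L.map fun m => strict (m.map (invPow 0)) N).sum := by
  induction hn : l.length using Nat.strong_induction_on generalizing l with
  | _ n ih =>
    match l, hl with
    | [], _ => exact ⟨[], by simp, fun N => by simp⟩
    | [a], _ => exact ⟨[], by simp, fun N => by simp [weak_cons, strict_cons]⟩
    | a :: b :: t, hl =>
      simp only [List.length_cons] at hn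
      simp only [List.mem_cons, forall_eq_or_imp] at hl
      obtain ⟨ha, hb, ht⟩ := hl
      obtain ⟨L₁, h₁, e₁⟩ :=
        ih (t.length + 1) (by omega) (b :: t) (by simpa using ⟨hb, ht⟩) (by simp)
      obtain ⟨L₂, h₂, e₂⟩ := ih (t.length + 1) (by omega) ((a + b) :: t)
        (by simpa using ⟨by omega, ht⟩) (by simp)
      refine ⟨L₁.map (List.cons a) ++ ((a + b) :: t) :: L₂, ?_, fun N => ?_⟩
      · simp only [List.mem_append, List.mem_map, List.mem_cons]
        rintro m (⟨m, hm, rfl⟩ | rfl | hm)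
        · obtain ⟨h3, h4, -⟩ := h₁ m hm
          exact ⟨by simp; omega, by simpa using ⟨ha, h4⟩, le_rfl⟩
        · exact ⟨by simp; omega, by simpa using ⟨by omega, ht⟩, by simp⟩
        · obtain ⟨h3, h4, h5⟩ := h₂ m hm
          exact ⟨by omega, h4, le_trans (by simp) h5⟩
      · have h3 : strict (invPow 0 a :: (b :: t).map (invPow 0)) N +
            (L₁.map fun m => strict (invPow 0 a :: m.map (invPow 0)) N).sum =
            ∑ m ∈ range N, invPow 0 a m * weak ((b :: t).map (invPow 0)) m := by
          simp only [e₁, mul_add, sum_add_distrib, strict_cons]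
          congr 1
          clear h₁ e₁
          induction L₁ with
          | nil => simp
          | cons m L ih => simp [ih, mul_add, sum_add_distrib]
        simp only [List.map_cons] at h3 e₂ ⊢
        rw [weak_cons_cons, ← h3, invPow_mul, e₂]
        simp only [List.map_append, List.map_map, List.sum_append, List.map_cons, List.sum_cons,
          Function.comp_def]
        ring

lemma tendsto_strict_invPow (s : List ℕ) (h1 : ∀ a ∈ s, 1 ≤ a) (h2 : s ≠ [] → 2 ≤ s.headI) :
    Tendsto (strict (s.map (invPow 0))) atTop (𝓝 (mzv s : ℂ)) := by
  rcases s with _ | ⟨a, s⟩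
  · rw [mzv_nil, Complex.ofReal_one]
    exact tendsto_const_nhds
  have h2 : 2 ≤ a := h2 (by simp)
  have h3 := tendsto_strict (p := (a :: s).length) (f := fun i => invPow 0 ((a :: s).get i))
    (d := Fin.cons (-2) fun _ => -1) (by simp) (fun i => by
      refine (growth_invPow 0 _).mono ?_
      refine Fin.cases ?_ (fun i => ?_) i
      · simp
        omega
      · have := h1 (s.get i) (by simp)
        simp at this ⊢
        omega) (by
      rw [List.ofFn_cons]
      refine ⟨by norm_num, ?_⟩
      rw [List.ofFn_const]
      have := admissible_neg_one (List.range s.length) (D := 0 + (-2) + 1) (by norm_num)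
      simpa using this)
  convert h3 using 2
  · rw [List.ofFn_comp' (a :: s).get, List.ofFn_get]
  · rw [mzv, Complex.ofReal_tsum]
    refine tsum_congr fun k => ?_
    rw [Complex.ofReal_prod]
    refine prod_congr rfl fun i _ => ?_
    have : ((k.1 i : ℕ) : ℂ) = ((k.1 i - 1 : ℕ) : ℂ) + 1 := by
      exact_mod_cast (Nat.sub_add_cancel (k.2.2 i)).symm
    simp [invPow, this]

lemma limIn_weak_sub_mzv (s : List ℕ) (h1 : ∀ a ∈ s, 1 ≤ a) (h2 : s ≠ [] → 2 ≤ s.headI) :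
    LimIn (mzvSpan K s.length) fun N => weak (s.map (invPow 0)) N - (mzv s : ℂ) := by
  obtain ⟨L, hL, hw⟩ := weak_eq_strict_add s h1
  have h3 : LimIn (mzvSpan K s.length) fun N =>
      (L.map fun m => strict (m.map (invPow 0)) N).sum := by
    clear hw
    induction L with
    | nil => simpa using LimIn.zero
    | cons m L ih =>
      simp only [List.map_cons, List.sum_cons]
      refine LimIn.add ?_ (ih fun x hx => hL x (List.mem_cons_of_mem _ hx))
      obtain ⟨h4, h5, h6⟩ := hL m List.mem_cons_self
      have hs : s ≠ [] := by
        rintro rfl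
        simp at h4
      have h7 : m ≠ [] → 2 ≤ m.headI := fun _ => (h2 hs).trans h6
      exact ⟨_, mzv_mem_mzvSpan h4 h5 h7, tendsto_strict_invPow m h5 h7⟩
  have h4 : LimIn (mzvSpan K s.length) fun N => strict (s.map (invPow 0)) N - (mzv s : ℂ) :=
    ⟨0, zero_mem _, by simpa using (tendsto_strict_invPow s h1 h2).sub_const (mzv s : ℂ)⟩
  refine (congrArg _ (funext fun N => ?_)).mp (h4.add h3)
  rw [hw]
  ring

lemma limIn_weak_of_mem_span {M : Submodule K ℂ} {S : Set (ℕ → ℂ)} {X l : List (ℕ → ℂ)}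
    (h : ∀ f ∈ S, LimIn M (weak (X ++ f :: l))) {g : ℕ → ℂ} (hg : g ∈ Submodule.span K S) :
    LimIn M (weak (X ++ g :: l)) := by
  have h0 (N : ℕ) : weak (X ++ 0 :: l) N = 0 := by
    have := weak_append_congr (weak_cons_add 0 0 l) X N
    rw [add_zero] at this
    linear_combination -this
  induction hg using Submodule.span_induction with
  | mem f hf => exact h f hf
  | zero => exact (congrArg _ (funext h0)).mpr LimIn.zero
  | add f g _ _ hf hg =>
    refine (congrArg _ (funext fun N => ?_)).mpr (hf.add hg)
    rw [weak_append_congr (weak_cons_add f g l) X N, one_mul]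
  | smul c f _ hf =>
    refine (congrArg _ (funext fun N => ?_)).mpr (hf.const_mul c.2)
    have := weak_append_congr (X := c • f :: l) (Y := 0 :: l) (Z := f :: l) (c := c)
      (fun N => by
        simp only [weak_cons, smul_apply_eq, mul_sum, mul_assoc, Pi.zero_apply, zero_mul,
          sum_const_zero, zero_add]) X N
    rw [this, h0, zero_add]

lemma limIn_weak_powSpan (l : List (ℕ → ℂ)) (hl : ∀ g ∈ l, g ∈ powSpan K) (s : List ℕ)
    (hs : s ≠ []) (h1 : ∀ a ∈ s, 1 ≤ a) (h2 : 2 ≤ s.headI) :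
    LimIn (mzvSpan K (s.length + l.length + 1)) (weak (s.map (invPow 0) ++ l)) := by
  induction l generalizing s with
  | nil =>
    have h3 : LimIn (mzvSpan K (s.length + 1)) fun _ => (mzv s : ℂ) :=
      ⟨_, mzv_mem_mzvSpan (by omega) h1 fun _ => h2, tendsto_const_nhds⟩
    refine (congrArg _ (funext fun N => ?_)).mp
      (((limIn_weak_sub_mzv s h1 fun _ => h2).mono (mzvSpan_mono (by omega))).add h3)
    simp
  | cons g l ih =>
    refine limIn_weak_of_mem_span ?_ (hl g List.mem_cons_self)
    rintro _ ⟨a, rfl⟩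
    have := ih (fun g hg => hl g (List.mem_cons_of_mem _ hg)) (s ++ [a + 1]) (by simp) (by
      simp only [List.mem_append, List.mem_singleton]
      rintro b (h | rfl)
      exacts [h1 b h, by omega]) (by cases s <;> simp_all)
    simpa [add_assoc, add_comm 1] using this

lemma expressible (p : ℕ) : Expressible K p := by
  induction p with
  | zero =>
    intro l hl _ _
    rw [List.length_eq_zero_iff] at hl
    subst hl
    exact ⟨1, one_mem_mzvSpan Nat.one_pos, tendsto_const_nhds⟩
  | succ p ih =>
    intro l hlen hl hadm
    have key (e : Entry) : ∃ g, e ∈ l → Represents K e.1 g := by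
      by_cases he : e ∈ l
      · obtain ⟨g, hg⟩ := exists_represents (hl e he).1
        exact ⟨g, fun _ => hg⟩
      · exact ⟨0, fun h => absurd h he⟩
    choose g hg using key
    have h1 := limIn_weak_sub_represents ih (l.map fun e => (e.1, g e, e.2)) (by simpa using hlen)
      (by
        simp only [List.mem_map]
        rintro _ ⟨e, he, rfl⟩
        exact ⟨hl e he, hg e he⟩) (by simpa [Function.comp_def] using hadm)
    have h2 : LimIn (mzvSpan K (p + 1 + 1)) (weak (l.map g)) := by
      rcases l with _ | ⟨e, l⟩
      · simp at hlen
      have h3 : Growth (-2) (g e) := growth_of_represents (hg e List.mem_cons_self)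
        ((hl e List.mem_cons_self).2.mono (by
          have := hadm.1
          omega))
      refine limIn_weak_of_mem_span (X := []) ?_
        (mem_span_of_growth (hg e List.mem_cons_self).1 h3)
      rintro _ ⟨s, rfl⟩
      have := limIn_weak_powSpan (K := K) (l.map g) (by
        simp only [List.mem_map]
        rintro _ ⟨x, hx, rfl⟩
        exact (hg x (List.mem_cons_of_mem _ hx)).1) [s + 2] (by simp) (by simp) (by simp)
      simp only [List.length_cons] at hlen
      simpa [hlen, add_comm 1] using this
    refine (congrArg _ (funext fun N => ?_)).mp ((h1.mono (mzvSpan_mono (by omega))).add h2)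
    simp [Function.comp_def]

end Depth

section PartialFractions

open Polynomial

variable {F ι : Type*} [Field F] [Fintype ι]

lemma pairwise_isCoprime {a : ι → F} (ha : Function.Injective a) :
    Set.Pairwise (univ : Finset ι) fun i j => IsCoprime (X + C (a i)) (X + C (a j)) := by
  intro i _ j _ hij
  have := pairwise_coprime_X_sub_C (neg_injective.comp ha) hij
  simpa [Function.onFun, sub_eq_add_neg] using this

variable [DecidableEq ι]

/-- The `c k t` are the coefficients of `(X + a k) ^ (t - A)` in the partial fraction
decomposition of `Q / ∏ k, (X + a k) ^ A`. -/
def IsPartialFraction (a : ι → F) (A : ℕ) (Q : F[X]) (c : ι → Fin A → F) : Prop :=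
  ∃ q : F[X], Q = q * ∏ k, (X + C (a k)) ^ A +
    ∑ k, ∑ t : Fin A, C (c k t) * (X + C (a k)) ^ t.1 * ∏ l ∈ univ.erase k, (X + C (a l)) ^ A

lemma exists_isPartialFraction {a : ι → F} (ha : Function.Injective a) (A : ℕ) (Q : F[X]) :
    ∃ c, IsPartialFraction a A Q c := by
  obtain ⟨q, r, hr, h⟩ := eq_quo_mul_prod_pow_add_sum_rem_mul_prod_pow Q (s := univ)
    (fun i _ => monic_X_add_C (a i)) (pairwise_isCoprime ha) fun _ => A
  have h1 (k : ι) (t : Fin A) : C ((r k t).coeff 0) = r k t := by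
    have h2 := hr k (mem_univ k) t
    rw [degree_X_add_C] at h2
    exact (eq_C_of_degree_le_zero (Nat.WithBot.lt_one_iff_le_zero.1 h2)).symm
  exact ⟨fun k t => (r k t).coeff 0, q, by simpa only [h1] using h⟩

namespace IsPartialFraction

variable {a : ι → F} {A : ℕ} {Q Q' : F[X]} {c c' : ι → Fin A → F}

lemma unique (ha : Function.Injective a) (h : IsPartialFraction a A Q c)
    (h' : IsPartialFraction a A Q c') : c = c' := by
  obtain ⟨q, h⟩ := h
  obtain ⟨q', h'⟩ := h'
  have hdeg (c : ι → Fin A → F) : ∀ i ∈ (univ : Finset ι), ∀ t,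
      (C (c i t)).degree < (X + C (a i)).degree := fun i _ t => by
    rw [degree_X_add_C]
    exact degree_C_le.trans_lt zero_lt_one
  have := quo_mul_prod_pow_add_sum_rem_mul_prod_pow_unique (s := univ)
    (fun i _ => monic_X_add_C (a i)) (pairwise_isCoprime ha) (hdeg c) (hdeg c') (h.symm.trans h')
  ext k t
  exact C_injective (congrFun (this.2 k (mem_univ k)) t)

lemma add (h : IsPartialFraction a A Q c) (h' : IsPartialFraction a A Q' c') :
    IsPartialFraction a A (Q + Q') (c + c') := by
  obtain ⟨q, rfl⟩ := h
  obtain ⟨q', rfl⟩ := h'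
  refine ⟨q + q', ?_⟩
  simp only [Pi.add_apply, C_add, add_mul, sum_add_distrib]
  ring

lemma smul (x : F) (h : IsPartialFraction a A Q c) : IsPartialFraction a A (x • Q) (x • c) := by
  obtain ⟨q, rfl⟩ := h
  refine ⟨x • q, ?_⟩
  simp only [Pi.smul_apply, smul_eq_mul, C_mul, smul_eq_C_mul, mul_add, mul_sum, mul_assoc]

lemma comp {b : ι → F} {L : F[X]} {ε : F} {τ : Equiv.Perm ι}
    (hL : ∀ k, (X + C (a k)).comp L = C ε * (X + C (b (τ k)))) (h : IsPartialFraction a A Q c) :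
    IsPartialFraction b A (Q.comp L) fun k t =>
      ε ^ (t.1 + A * (Fintype.card ι - 1)) * c (τ.symm k) t := by
  obtain ⟨q, rfl⟩ := h
  refine ⟨q.comp L * C (ε ^ (A * Fintype.card ι)), ?_⟩
  have h1 (s : Finset ι) : (∏ l ∈ s, (X + C (a l)) ^ A).comp L =
      C (ε ^ (A * #s)) * ∏ l ∈ s, (X + C (b (τ l))) ^ A := by
    rw [Polynomial.prod_comp]
    simp only [pow_comp, hL, mul_pow, prod_mul_distrib, prod_const, ← C_pow, ← pow_mul]
  rw [add_comp, mul_comp, h1, Equiv.prod_comp τ fun l => (X + C (b l)) ^ A, card_univ, mul_assoc]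
  congr 1
  rw [Polynomial.sum_comp]
  refine (sum_congr rfl fun k _ => ?_).trans (Equiv.sum_comp τ _)
  rw [Polynomial.sum_comp]
  refine sum_congr rfl fun t _ => ?_
  have h2 : univ.erase (τ k) = (univ.erase k).map τ.toEmbedding := by
    rw [map_erase]
    simp
  rw [mul_comp, mul_comp, h1, C_comp, pow_comp, hL, h2, prod_map, card_erase_of_mem (mem_univ k),
    card_univ]
  simp only [Equiv.coe_toEmbedding, Equiv.symm_apply_apply, mul_pow, C_mul, pow_add, C_pow]
  ring

end IsPartialFraction

/-- The sum over `k` of the coefficients of `(X + a k) ^ (-s)` in the partial fraction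
decomposition of `Q / ∏ k, (X + a k) ^ A`, as a linear form in `Q`. -/
noncomputable def polarCoeff {a : ι → F} (ha : Function.Injective a) (A s : ℕ) : F[X] →ₗ[F] F where
  toFun Q := ∑ k, ∑ t : Fin A, if t.1 + s = A then
    (exists_isPartialFraction ha A Q).choose k t else 0
  map_add' Q Q' := by
    rw [(exists_isPartialFraction ha A (Q + Q')).choose_spec.unique ha
      ((exists_isPartialFraction ha A Q).choose_spec.add
        (exists_isPartialFraction ha A Q').choose_spec)]
    simp only [← sum_add_distrib, Pi.add_apply]
    refine sum_congr rfl fun k _ => sum_congr rfl fun t _ => ?_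
    split_ifs <;> simp
  map_smul' x Q := by
    rw [(exists_isPartialFraction ha A (x • Q)).choose_spec.unique ha
      ((exists_isPartialFraction ha A Q).choose_spec.smul x)]
    simp [mul_sum]

lemma IsPartialFraction.polarCoeff_eq {a : ι → F} (ha : Function.Injective a) {A : ℕ} {Q : F[X]}
    {c : ι → Fin A → F} (h : IsPartialFraction a A Q c) (s : ℕ) :
    polarCoeff ha A s Q = ∑ k, ∑ t : Fin A, if t.1 + s = A then c k t else 0 := by
  rw [h.unique ha (exists_isPartialFraction ha A Q).choose_spec]
  rfl

lemma polarCoeff_eq_zero {a : ι → F} (ha : Function.Injective a) {A s : ℕ}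
    (hs : ¬(1 ≤ s ∧ s ≤ A)) : polarCoeff ha A s = 0 := by
  ext Q
  refine sum_eq_zero fun k _ => sum_eq_zero fun t _ => if_neg fun h => hs ?_
  have := t.2
  omega

lemma polarCoeff_comp [Nonempty ι] {a b : ι → F} (ha : Function.Injective a)
    (hb : Function.Injective b)
    {L : F[X]} {ε : F} (hε : ε * ε = 1) {τ : Equiv.Perm ι}
    (hL : ∀ k, (X + C (a k)).comp L = C ε * (X + C (b (τ k)))) (A s : ℕ) (Q : F[X]) :
    polarCoeff hb A s (Q.comp L) = ε ^ (A * Fintype.card ι + s) * polarCoeff ha A s Q := by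
  obtain ⟨c, hc⟩ := exists_isPartialFraction ha A Q
  rw [hc.polarCoeff_eq ha, (hc.comp hL).polarCoeff_eq hb, ← Equiv.sum_comp τ]
  simp only [mul_sum, Equiv.symm_apply_apply]
  refine sum_congr rfl fun k _ => sum_congr rfl fun t _ => ?_
  split_ifs with h
  · congr 1
    have h1 : A * Fintype.card ι + s = t + A * (Fintype.card ι - 1) + 2 * s := by
      obtain ⟨m, hm⟩ := Nat.exists_eq_add_of_lt (Fintype.card_pos (α := ι))
      rw [hm]
      simp only [zero_add, Nat.add_sub_cancel, mul_add, mul_one]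
      omega
    rw [h1, pow_add _ _ (2 * s), pow_mul _ 2, sq, hε, one_pow, mul_one]
  · simp

end PartialFractions

section Symmetry

open Polynomial

variable {F : Type*} [Field F] [CharZero F]

lemma shift_injective (n r : ℕ) :
    Function.Injective fun k : Fin (n + 1) => ((r + k.1 : ℕ) : F) := fun k l h => by
  have : r + k.1 = r + l.1 := Nat.cast_injective (R := F) h
  exact Fin.ext (by omega)

/-- The linear form sending `Q` to the total coefficient of the poles of order `s` of
`Q / ((X + r) ⋯ (X + r + n)) ^ A`. -/
noncomputable def poleCoeff (n A r s : ℕ) : F[X] →ₗ[F] F :=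
  polarCoeff (shift_injective n r) A s

lemma poleCoeff_eq_zero {n A r s : ℕ} (hs : ¬(1 ≤ s ∧ s ≤ A)) :
    poleCoeff (F := F) n A r s = 0 := polarCoeff_eq_zero _ hs

/-- The substitution exchanging the poles of two Pochhammer symbols of the same length. -/
noncomputable def affine (n r r' : ℕ) (ε : ℤˣ) : F[X] :=
  C ((ε : ℤ) : F) * (X + C ((r' : F) + n / 2)) - C ((r : F) + n / 2)

lemma poleCoeff_comp_affine (n A r r' s : ℕ) (ε : ℤˣ) (Q : F[X]) :
    poleCoeff n A r' s (Q.comp (affine n r r' ε)) =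
      ((ε : ℤ) : F) ^ (A * (n + 1) + s) * poleCoeff n A r s Q := by
  have hε : ((ε : ℤ) : F) * ((ε : ℤ) : F) = 1 := by
    rw [← Int.cast_mul, ← Units.val_mul, Int.units_mul_self]
    simp
  suffices h : ∃ τ : Equiv.Perm (Fin (n + 1)), ∀ k : Fin (n + 1),
      (X + C ((r + k.1 : ℕ) : F)).comp (affine n r r' ε) =
        C ((ε : ℤ) : F) * (X + C ((r' + (τ k).1 : ℕ) : F)) by
    obtain ⟨τ, hτ⟩ := h
    have := polarCoeff_comp (shift_injective n r) (shift_injective n r') hε hτ A s Q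
    rwa [Fintype.card_fin] at this
  rcases Int.units_eq_one_or ε with rfl | rfl
  · refine ⟨Equiv.refl _, fun k => ?_⟩
    simp [affine]
    ring
  · refine ⟨Fin.revPerm, fun k => ?_⟩
    have h1 : ((n - k.1 : ℕ) : F) = n - k.1 := Nat.cast_sub (by omega)
    have h2 : (C (n : F) : F[X]) = C ((n : F) / 2) + C ((n : F) / 2) := by
      rw [← C_add, add_halves]
    simp only [affine, add_comp, X_comp, C_comp, Fin.revPerm_apply, Fin.val_rev,
      Nat.add_sub_add_right, Nat.cast_add, h1, C_add, C_sub, h2, Units.val_neg, Units.val_one,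
      Int.cast_neg, Int.cast_one, C_neg, C_1]
    ring

variable {p : ℕ}

/-- The linear form sending `P` to the total coefficient of the poles of orders `s` of
`P / ∏ i, ((X i + r i) ⋯ (X i + r i + n i)) ^ A i`. -/
noncomputable def multiPoleCoeff (n A r s : Fin p → ℕ) : MvPolynomial (Fin p) F →ₗ[F] F :=
  (MvPolynomial.basisMonomials (Fin p) F).constr F fun m =>
    ∏ i, poleCoeff (n i) (A i) (r i) (s i) (X ^ m i)

lemma multiPoleCoeff_monomial (n A r s : Fin p → ℕ) (m : Fin p →₀ ℕ) :
    multiPoleCoeff n A r s (MvPolynomial.monomial m (1 : F)) =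
      ∏ i, poleCoeff (n i) (A i) (r i) (s i) (X ^ m i) := by
  have := (MvPolynomial.basisMonomials (Fin p) F).constr_basis F
    (fun m => ∏ i, poleCoeff (F := F) (n i) (A i) (r i) (s i) (X ^ m i)) m
  rwa [MvPolynomial.coe_basisMonomials] at this

lemma multiPoleCoeff_prod (n A r s : Fin p → ℕ) (Q : Fin p → F[X]) :
    multiPoleCoeff n A r s (∏ i, aeval (MvPolynomial.X i) (Q i)) =
      ∏ i, poleCoeff (n i) (A i) (r i) (s i) (Q i) := by
  have h : (multiPoleCoeff n A r s).compMultilinearMap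
      ((MultilinearMap.mkPiAlgebra F (Fin p) (MvPolynomial (Fin p) F)).compLinearMap
        fun i => (aeval (R := F) (MvPolynomial.X i : MvPolynomial (Fin p) F)).toLinearMap) =
      (MultilinearMap.mkPiAlgebra F (Fin p) F).compLinearMap
        fun i => poleCoeff (n i) (A i) (r i) (s i) := by
    refine Module.Basis.ext_multilinear (fun _ => basisMonomials F) fun (v : Fin p → ℕ) => ?_
    have h1 : ∏ i, (MvPolynomial.X i : MvPolynomial (Fin p) F) ^ v i =
        MvPolynomial.monomial (Finsupp.equivFunOnFinite.symm v) 1 := by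
      rw [MvPolynomial.monomial_eq, Finsupp.prod_fintype _ _ fun i => pow_zero _]
      simp
    simp [← monomial_one_right_eq_X_pow, h1, multiPoleCoeff_monomial]
  exact congrArg (fun φ => φ Q) h

/-- The substitution `K i ↦ ε (γ i) * K (γ i)`, where `K i = X i + r i + n i / 2`. -/
noncomputable def signedPerm (n r : Fin p → ℕ) (ε : Fin p → ℤˣ) (γ : Equiv.Perm (Fin p)) :
    MvPolynomial (Fin p) F →ₐ[F] MvPolynomial (Fin p) F :=
  MvPolynomial.aeval fun i =>
    aeval (MvPolynomial.X (γ i)) (affine (F := F) (n i) (r i) (r (γ i)) (ε (γ i)))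

lemma multiPoleCoeff_signedPerm {n A : Fin p → ℕ} (r s : Fin p → ℕ) (ε : Fin p → ℤˣ)
    {γ : Equiv.Perm (Fin p)} (hn : ∀ i, n (γ i) = n i) (hA : ∀ i, A (γ i) = A i)
    (P : MvPolynomial (Fin p) F) :
    multiPoleCoeff n A r s (signedPerm n r ε γ P) =
      (∏ i, ((ε i : ℤ) : F) ^ (A i * (n i + 1) + s i)) *
        multiPoleCoeff n A r (fun i => s (γ i)) P := by
  suffices h : (multiPoleCoeff n A r s) ∘ₗ (signedPerm n r ε γ).toLinearMap =
      LinearMap.mulLeft F (∏ i, ((ε i : ℤ) : F) ^ (A i * (n i + 1) + s i)) ∘ₗ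
        multiPoleCoeff n A r (fun i => s (γ i)) from LinearMap.congr_fun h P
  refine (MvPolynomial.basisMonomials (Fin p) F).ext fun m => ?_
  rw [MvPolynomial.coe_basisMonomials]
  have h1 : signedPerm n r ε γ (MvPolynomial.monomial m (1 : F)) = ∏ i,
      aeval (R := F) (MvPolynomial.X i : MvPolynomial (Fin p) F)
      (((X : F[X]) ^ m (γ.symm i)).comp (affine (n i) (r (γ.symm i)) (r i) (ε i))) := by
    rw [signedPerm, MvPolynomial.aeval_monomial, map_one, one_mul,
      Finsupp.prod_fintype _ _ fun i => pow_zero _]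
    refine Eq.trans (prod_congr rfl fun i _ => ?_) (Equiv.prod_comp γ _)
    simp [hn]
  simp only [LinearMap.comp_apply, AlgHom.toLinearMap_apply, LinearMap.mulLeft_apply,
    multiPoleCoeff_monomial, h1, multiPoleCoeff_prod, poleCoeff_comp_affine, prod_mul_distrib]
  congr 1
  rw [← Equiv.prod_comp γ]
  simp [hn, hA]

end Symmetry

section PochhammerQuotient

variable {K : Subfield ℂ}

lemma ascPochhammer_eval_eq_prod {R : Type*} [CommSemiring R] (n : ℕ) (x : R) :
    (ascPochhammer R n).eval x = ∏ k : Fin n, (x + k.1) := by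
  induction n with
  | zero => simp
  | succ n ih => rw [ascPochhammer_succ_eval, ih, Fin.prod_univ_castSucc]; simp

/-- The sequence `k ↦ k ^ e / ((k + r)_{n + 1}) ^ A`, indexed by `m = k - 1`. -/
noncomputable def quot (n A r e : ℕ) : ℕ → ℂ := fun m =>
  ((m : ℂ) + 1) ^ e / (ascPochhammer ℂ (n + 1)).eval ((m : ℂ) + 1 + r) ^ A

lemma quot_eq (n A r e : ℕ) :
    quot n A r e = ((fun m : ℕ => (m : ℂ)) + 1) ^ e * ∏ k : Fin (n + 1), invPow (r + k.1) A := by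
  ext m
  rw [quot, ascPochhammer_eval_eq_prod, div_eq_mul_inv, ← prod_pow, ← prod_inv_distrib]
  simp only [Pi.mul_apply, Pi.pow_apply, Pi.add_apply, Pi.one_apply, prod_apply, invPow]
  congr 1
  refine prod_congr rfl fun k _ => ?_
  push_cast
  congr 2
  ring

lemma quot_mem_rat (n A r e : ℕ) : quot n A r e ∈ rat K := by
  rw [quot_eq]
  exact mul_mem (pow_mem (add_mem id_mem_rat (one_mem _)) _)
    (prod_mem fun k _ => invPow_mem_rat _ _)

lemma growth_prod {ι : Type*} (s : Finset ι) {d : ι → ℤ} {f : ι → ℕ → ℂ}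
    (h : ∀ i ∈ s, Growth (d i) (f i)) : Growth (∑ i ∈ s, d i) (∏ i ∈ s, f i) := by
  classical
  induction s using Finset.induction_on with
  | empty => exact ⟨1, zero_le_one, by simp⟩
  | insert i s hi ih =>
    rw [sum_insert hi, prod_insert hi]
    exact (h i (mem_insert_self i s)).mul (ih fun j hj => h j (mem_insert_of_mem hj))

lemma growth_quot (n A r e : ℕ) : Growth ((e : ℤ) - A * (n + 1)) (quot n A r e) := by
  rw [quot_eq]
  have h1 : Growth e (((fun m : ℕ => (m : ℂ)) + 1) ^ e) := by
    refine ⟨1, zero_le_one, fun m => ?_⟩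
    have : (m : ℂ) + 1 = ((m + 1 : ℕ) : ℂ) := by push_cast; ring
    rw [Pi.pow_apply, Pi.add_apply, Pi.one_apply, this, norm_pow, Complex.norm_natCast]
    simp
  have h2 := growth_prod univ fun (k : Fin (n + 1)) _ => growth_invPow (r + k.1) A
  refine (h1.mul h2).mono (le_of_eq ?_)
  simp
  ring

lemma Represents.zero : Represents K 0 0 :=
  ⟨zero_mem _, 0, zero_mem _, 0, zero_mem _, by ext; simp [diff]⟩

lemma Represents.add {f f' g g' : ℕ → ℂ} (h : Represents K f g) (h' : Represents K f' g') :
    Represents K (f + f') (g + g') := by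
  obtain ⟨hg, Q, hQ, G, hG, rfl⟩ := h
  obtain ⟨hg', Q', hQ', G', hG', rfl⟩ := h'
  refine ⟨add_mem hg hg', Q + Q', add_mem hQ hQ', G + G', add_mem hG hG', ?_⟩
  rw [diff_add]
  abel

lemma Represents.smul (c : K) {f g : ℕ → ℂ} (h : Represents K f g) :
    Represents K (c • f) (c • g) := by
  obtain ⟨hg, Q, hQ, G, hG, rfl⟩ := h
  refine ⟨Submodule.smul_mem _ c hg, c • Q, Submodule.smul_mem _ c hQ, c • G,
    Submodule.smul_mem _ c hG, ?_⟩
  rw [diff_smul, smul_add, smul_add]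

lemma Represents.sum {ι : Type*} {s : Finset ι} {f g : ι → ℕ → ℂ}
    (h : ∀ i ∈ s, Represents K (f i) (g i)) : Represents K (∑ i ∈ s, f i) (∑ i ∈ s, g i) := by
  classical
  induction s using Finset.induction_on with
  | empty => exact Represents.zero
  | insert i s hi ih =>
    rw [sum_insert hi, sum_insert hi]
    exact (h i (mem_insert_self i s)).add (ih fun j hj => h j (mem_insert_of_mem hj))

lemma represents_invPow (a s : ℕ) : Represents K (invPow a (s + 1)) (invPow 0 (s + 1)) := by
  refine ⟨Submodule.subset_span ⟨s, rfl⟩, 0, zero_mem _, ∑ b ∈ range a, invPow b (s + 1),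
    Submodule.sum_mem _ fun b _ => invPow_mem_frac b s, ?_⟩
  rw [zero_add, ← invPow_eq_add_diff]

lemma represents_polynomial (q : Polynomial K) :
    Represents K (fun m => q.eval₂ K.subtype ((m : ℂ) + 1)) 0 := by
  refine ⟨zero_mem _, _, ?_, 0, zero_mem _, (add_eq_left.2 (by ext; simp [diff])).symm⟩
  have h (m : ℕ) : q.eval₂ K.subtype ((m : ℂ) + 1) =
      (q.comp (Polynomial.X + 1)).eval₂ K.subtype (m : ℂ) := by
    rw [Polynomial.eval₂_comp]
    simp
  simp only [h]
  induction q.comp (Polynomial.X + 1) using Polynomial.induction_on' with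
  | add q q' hq hq' =>
    simp only [Polynomial.eval₂_add]
    exact add_mem hq hq'
  | monomial e c =>
    simp only [Polynomial.eval₂_monomial]
    exact Submodule.smul_mem _ c (pow_mem_pol e)

/-- The pole part of `quot n A r e`, with all poles moved to `0`. -/
noncomputable def polePart (K : Subfield ℂ) (n A r e : ℕ) : ℕ → ℂ :=
  ∑ s ∈ Icc 1 A, poleCoeff (F := K) n A r s (Polynomial.X ^ e) • invPow 0 s

lemma represents_quot (n A r e : ℕ) : Represents K (quot n A r e) (polePart K n A r e) := by
  obtain ⟨c, hc⟩ := exists_isPartialFraction (shift_injective (F := K) n r) A (Polynomial.X ^ e)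
  have h1 : polePart K n A r e =
      0 + ∑ k : Fin (n + 1), ∑ t : Fin A, c k t • invPow 0 (A - 1 - t.1 + 1) := by
    simp only [polePart, poleCoeff, hc.polarCoeff_eq, sum_smul, zero_add]
    rw [sum_comm]
    refine sum_congr rfl fun k _ => ?_
    rw [sum_comm]
    refine sum_congr rfl fun t _ => ?_
    have := t.2
    rw [sum_eq_single (A - 1 - t.1 + 1)]
    · rw [if_pos (by omega)]
    · intro s _ hs
      rw [if_neg (by omega), zero_smul]
    · intro h
      rw [mem_Icc] at h
      omega
  obtain ⟨q, hq⟩ := hc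
  have h2 : quot n A r e = (fun m : ℕ => q.eval₂ K.subtype ((m : ℂ) + 1)) +
      ∑ k : Fin (n + 1), ∑ t : Fin A, c k t • invPow (r + k.1) (A - 1 - t.1 + 1) := by
    ext m
    have h3 := congrArg (Polynomial.eval₂ K.subtype ((m : ℂ) + 1)) hq
    simp only [Polynomial.eval₂_add, Polynomial.eval₂_mul, Polynomial.eval₂_finsetSum,
      Polynomial.eval₂_finsetProd, Polynomial.eval₂_pow, Polynomial.eval₂_X,
      Polynomial.eval₂_C, Subfield.subtype_apply] at h3
    have h0 (k : Fin (n + 1)) : (m : ℂ) + 1 + ((r + k.1 : ℕ) : K) ≠ 0 := by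
      have := cast_add_ne_zero m (r + k.1)
      push_cast at this ⊢
      convert this using 1
      ring
    have hD : ∏ k : Fin (n + 1), ((m : ℂ) + 1 + ((r + k.1 : ℕ) : K)) ^ A ≠ 0 :=
      prod_ne_zero_iff.2 fun k _ => pow_ne_zero _ (h0 k)
    have h4 : quot n A r e m = ((m : ℂ) + 1) ^ e /
        ∏ k : Fin (n + 1), ((m : ℂ) + 1 + ((r + k.1 : ℕ) : K)) ^ A := by
      rw [quot, ascPochhammer_eval_eq_prod, ← prod_pow]
      congr 1
      refine prod_congr rfl fun k _ => ?_
      push_cast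
      ring
    rw [h4, div_eq_iff hD, h3, Pi.add_apply, add_mul]
    congr 1
    simp only [Finset.sum_apply, sum_mul, smul_apply_eq]
    refine sum_congr rfl fun k _ => sum_congr rfl fun t _ => ?_
    rw [← mul_prod_erase _ _ (mem_univ k), invPow, ← mul_assoc]
    congr 1
    have h5 : (m : ℂ) + ((r + k.1 : ℕ) : ℂ) + 1 = (m : ℂ) + 1 + ((r + k.1 : ℕ) : K) := by
      push_cast
      ring
    have h6 : A - 1 - t.1 + 1 + t.1 = A := by
      have := t.2
      omega
    rw [h5, mul_assoc]
    congr 1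
    rw [eq_inv_mul_iff_mul_eq₀ (pow_ne_zero _ (h0 k)), ← pow_add, h6]
  rw [h1, h2]
  exact (represents_polynomial q).add
    (Represents.sum fun k _ => Represents.sum fun t _ => (represents_invPow _ _).smul _)

lemma poleCoeff_one_eq_zero {n A r e : ℕ} (h : e + 2 ≤ A * (n + 1)) :
    poleCoeff (F := K) n A r 1 (Polynomial.X ^ e) = 0 := by
  rcases Nat.eq_zero_or_pos A with rfl | hA
  · rw [poleCoeff_eq_zero (by omega), LinearMap.zero_apply]
  have h1 : Growth (-2) (polePart K n A r e) :=
    growth_of_represents (represents_quot n A r e) ((growth_quot n A r e).mono (by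
      have : ((e + 2 : ℕ) : ℤ) ≤ ((A * (n + 1) : ℕ) : ℤ) := by exact_mod_cast h
      push_cast at this
      omega))
  have h2 : Growth (-2) (∑ s ∈ Ioc 1 A,
      poleCoeff (F := K) n A r s (Polynomial.X ^ e) • invPow 0 s) :=
    Growth.sum _ fun s hs => ((growth_invPow 0 s).mono (by
      have := (mem_Ioc.1 hs).1
      omega)).const_mul _
  have h3 := h1.sub h2
  rw [polePart, ← add_sum_Ioc_eq_sum_Icc hA, add_sub_cancel_right] at h3
  exact_mod_cast eq_zero_of_growth_smul h3

end PochhammerQuotient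

section MultipleSum

variable {K : Subfield ℂ} {p : ℕ}

lemma weak_polePart (n A r e : Fin p → ℕ) (N : ℕ) :
    weak (List.ofFn fun i => polePart K (n i) (A i) (r i) (e i)) N =
      ∑ s ∈ Fintype.piFinset fun i => Icc 1 (A i),
        ((∏ i, poleCoeff (F := K) (n i) (A i) (r i) (s i) (Polynomial.X ^ e i) : K) : ℂ) *
          weak ((List.ofFn s).map (invPow 0)) N := by
  simp only [List.map_ofFn, weak_ofFn, mul_sum]
  rw [sum_comm]
  refine sum_congr rfl fun k _ => ?_
  simp only [polePart, Finset.sum_apply, prod_univ_sum, smul_apply_eq, prod_mul_distrib,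
    Function.comp_apply]
  refine sum_congr rfl fun s _ => ?_
  push_cast
  rfl

lemma limIn_weak_quot (hp : 0 < p) (n A r e : Fin p → ℕ)
    (h : ∀ j : Fin p, ∑ i ∈ Iic j, e i + j.1 + 2 ≤ ∑ i ∈ Iic j, A i * (n i + 1))
    (hadm : Admissible 0 (List.ofFn fun i => (e i : ℤ) - A i * (n i + 1))) :
    LimIn (mzvSpan K p) fun N => weak (List.ofFn fun i => quot (n i) (A i) (r i) (e i)) N -
      ∑ s ∈ Fintype.piFinset fun i => Icc 1 (A i),
        ((∏ i, poleCoeff (F := K) (n i) (A i) (r i) (s i) (Polynomial.X ^ e i) : K) : ℂ) *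
          (mzv (List.ofFn s) : ℂ) := by
  obtain ⟨q, rfl⟩ := Nat.exists_eq_add_one_of_ne_zero hp.ne'
  have h1 := limIn_weak_sub_represents (expressible (K := K) q)
    (List.ofFn fun i => (quot (n i) (A i) (r i) (e i), polePart K (n i) (A i) (r i) (e i),
      (e i : ℤ) - A i * (n i + 1))) (by simp)
    (by
      simp only [List.mem_ofFn, forall_exists_index, forall_apply_eq_imp_iff]
      exact fun i => ⟨⟨quot_mem_rat _ _ _ _, growth_quot _ _ _ _⟩, represents_quot _ _ _ _⟩)
    (by simpa only [List.map_ofFn, Function.comp_def] using hadm)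
  simp only [List.map_ofFn, Function.comp_def, weak_polePart] at h1
  have h2 : LimIn (mzvSpan K (q + 1)) fun N => ∑ s ∈ Fintype.piFinset fun i => Icc 1 (A i),
      ((∏ i, poleCoeff (F := K) (n i) (A i) (r i) (s i) (Polynomial.X ^ e i) : K) : ℂ) *
        (weak ((List.ofFn s).map (invPow 0)) N - (mzv (List.ofFn s) : ℂ)) := by
    refine LimIn.sum fun s hs => ?_
    have hs' (i) : 1 ≤ s i := (mem_Icc.1 (Fintype.mem_piFinset.1 hs i)).1
    by_cases h0 : 2 ≤ s 0
    · have h3 := limIn_weak_sub_mzv (K := K) (List.ofFn s) (by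
          simp only [List.mem_ofFn, forall_exists_index, forall_apply_eq_imp_iff]
          exact hs')
        (by simpa [List.ofFn_succ] using h0)
      rw [List.length_ofFn] at h3
      exact h3.const_mul (SetLike.coe_mem _)
    · have h3 : s 0 = 1 := by
        have := hs' 0
        omega
      have h4 := h 0
      have h5 : Iic (0 : Fin (q + 1)) = {0} := by
        ext i
        simp
      rw [h5, sum_singleton, sum_singleton] at h4
      have h6 : ∏ i, poleCoeff (F := K) (n i) (A i) (r i) (s i) (Polynomial.X ^ e i) = 0 :=
        prod_eq_zero (mem_univ 0) (by
          rw [h3]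
          exact poleCoeff_one_eq_zero (by simpa using h4))
      simpa [h6] using LimIn.zero
  convert h1.add h2 using 1
  ext N
  simp only [mul_sub, sum_sub_distrib, List.map_ofFn, Function.comp_def, sub_add_sub_cancel]

lemma multiPoleCoeff_eq_sum {F : Type*} [Field F] [CharZero F] (n A r s : Fin p → ℕ)
    (P : MvPolynomial (Fin p) F) : multiPoleCoeff n A r s P = ∑ m ∈ P.support,
      P.coeff m * ∏ i, poleCoeff (n i) (A i) (r i) (s i) (Polynomial.X ^ m i) := by
  conv_lhs => rw [P.as_sum]
  rw [map_sum]
  refine sum_congr rfl fun m _ => ?_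
  rw [← multiPoleCoeff_monomial, ← smul_eq_mul, ← map_smul, MvPolynomial.smul_monomial,
    smul_eq_mul, mul_one]

lemma multiPoleCoeff_eq_zero {F : Type*} [Field F] [CharZero F] {n A r s : Fin p → ℕ}
    {i : Fin p} (hi : ¬(1 ≤ s i ∧ s i ≤ A i)) (P : MvPolynomial (Fin p) F) :
    multiPoleCoeff n A r s P = 0 := by
  rw [multiPoleCoeff_eq_sum]
  refine sum_eq_zero fun m _ => ?_
  rw [prod_eq_zero (mem_univ i) (by rw [poleCoeff_eq_zero hi, LinearMap.zero_apply]), mul_zero]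

lemma multiPoleCoeff_eq_zero_of_eq_one {n A r s : Fin p → ℕ} {i : Fin p} (hs : s i = 1)
    {P : MvPolynomial (Fin p) K} (h : P.degreeOf i + 2 ≤ A i * (n i + 1)) :
    multiPoleCoeff n A r s P = 0 := by
  rw [multiPoleCoeff_eq_sum]
  refine sum_eq_zero fun m hm => ?_
  have := MvPolynomial.monomial_le_degreeOf i hm
  rw [prod_eq_zero (mem_univ i) (by rw [hs, poleCoeff_one_eq_zero (by omega)]), mul_zero]

lemma summable_and_tsum_sub_mem (hp : 0 < p) (n A r : Fin p → ℕ) (P : MvPolynomial (Fin p) K)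
    (h : ∀ j : Fin p, ∑ i ∈ Iic j, P.degreeOf i + j.1 + 2 ≤ ∑ i ∈ Iic j, A i * (n i + 1)) :
    Summable (fun k : {k : Fin p → ℕ // Antitone k ∧ ∀ i, 1 ≤ k i} =>
      MvPolynomial.eval₂ K.subtype (fun i => (k.1 i : ℂ)) P /
        ∏ i, ((ascPochhammer ℂ (n i + 1)).eval ((k.1 i : ℂ) + r i)) ^ A i) ∧
    (∑' k : {k : Fin p → ℕ // Antitone k ∧ ∀ i, 1 ≤ k i},
      MvPolynomial.eval₂ K.subtype (fun i => (k.1 i : ℂ)) P /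
        ∏ i, ((ascPochhammer ℂ (n i + 1)).eval ((k.1 i : ℂ) + r i)) ^ A i) -
      ∑ s ∈ Fintype.piFinset fun i => Icc 1 (A i),
        ((multiPoleCoeff n A r s P : K) : ℂ) * (mzv (List.ofFn s) : ℂ) ∈ mzvSpan K p := by
  have h1 (k : {k : Fin p → ℕ // Antitone k ∧ ∀ i, 1 ≤ k i}) :
      MvPolynomial.eval₂ K.subtype (fun i => (k.1 i : ℂ)) P /
        ∏ i, ((ascPochhammer ℂ (n i + 1)).eval ((k.1 i : ℂ) + r i)) ^ A i =
      ∑ m ∈ P.support, ((P.coeff m : K) : ℂ) *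
        ∏ i, quot (n i) (A i) (r i) (m i) (k.1 i - 1) := by
    rw [MvPolynomial.eval₂_eq', sum_div]
    refine sum_congr rfl fun m _ => ?_
    rw [mul_div_assoc, ← prod_div_distrib]
    congr 1
    refine prod_congr rfl fun i _ => ?_
    rw [quot, Nat.cast_sub (k.2.2 i), Nat.cast_one, sub_add_cancel]
  have h2 (m) (hm : m ∈ P.support) (j : Fin p) :
      ∑ i ∈ Iic j, m i + j.1 + 2 ≤ ∑ i ∈ Iic j, A i * (n i + 1) := by
    have : ∑ i ∈ Iic j, m i ≤ ∑ i ∈ Iic j, P.degreeOf i :=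
      sum_le_sum fun i _ => MvPolynomial.monomial_le_degreeOf i hm
    have := h j
    omega
  have h3 (m) (hm : m ∈ P.support) :
      Admissible 0 (List.ofFn fun i => (m i : ℤ) - A i * (n i + 1)) := by
    refine (admissible_ofFn _ _).2 fun j => ?_
    have := h2 m hm j
    zify at this
    rw [sum_add_distrib, sum_sub_distrib, sum_const, Fin.card_Iic, nsmul_eq_mul, mul_one]
    push_cast
    linarith
  have h4 (m) (hm : m ∈ P.support) :=
    summable_weak (f := fun i => quot (n i) (A i) (r i) (m i)) hp
      (fun i => growth_quot (n i) (A i) (r i) (m i)) (h3 m hm)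
  simp only [h1]
  refine ⟨summable_sum fun m hm => (h4 m hm).1.mul_left _, ?_⟩
  rw [Summable.tsum_finsetSum fun m hm => (h4 m hm).1.mul_left _]
  simp only [multiPoleCoeff_eq_sum, AddSubmonoidClass.coe_finsetSum, sum_mul]
  rw [sum_comm, ← sum_sub_distrib]
  refine Submodule.sum_mem _ fun m hm => ?_
  obtain ⟨x, hx, hlim⟩ := limIn_weak_quot (K := K) hp n A r m (h2 m hm) (h3 m hm)
  have h5 := tendsto_nhds_unique hlim ((h4 m hm).2.sub_const _)
  rw [h5] at hx
  convert (mzvSpan K p).smul_mem (P.coeff m) hx using 1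
  simp only [tsum_mul_left, Subfield.smul_def, smul_eq_mul, mul_sub, mul_sum, MulMemClass.coe_mul,
    mul_assoc]

lemma ascPochhammer_eval_reflect (n : ℕ) (ε : ℤˣ) (x : ℂ) :
    (ascPochhammer ℂ (n + 1)).eval (((ε : ℤ) : ℂ) * (x + n / 2) - n / 2) =
      ((ε : ℤ) : ℂ) ^ (n + 1) * (ascPochhammer ℂ (n + 1)).eval x := by
  rcases Int.units_eq_one_or ε with rfl | rfl
  · simp
  · simp only [ascPochhammer_eval_eq_prod]
    rw [← Equiv.prod_comp Fin.revPerm fun k : Fin (n + 1) => x + (k.1 : ℂ)]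
    have : ((((-1 : ℤˣ) : ℤ) : ℂ)) ^ (n + 1) =
        ∏ _k : Fin (n + 1), ((((-1 : ℤˣ) : ℤ) : ℂ)) := by simp
    rw [this, ← prod_mul_distrib]
    refine prod_congr rfl fun k _ => ?_
    have h1 : ((n - k.1 : ℕ) : ℂ) = n - k.1 := Nat.cast_sub (by omega)
    simp only [Fin.revPerm_apply, Fin.val_rev, Nat.add_sub_add_right, h1, Units.val_neg,
      Units.val_one, Int.cast_neg, Int.cast_one]
    ring

lemma eval₂_signedPerm (n r : Fin p → ℕ) (ε : Fin p → ℤˣ) (γ : Equiv.Perm (Fin p))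
    (k : Fin p → ℂ) (P : MvPolynomial (Fin p) K) :
    MvPolynomial.eval₂ K.subtype k (signedPerm n r ε γ P) =
      MvPolynomial.eval₂ K.subtype (fun i => ((ε (γ i) : ℤ) : ℂ) *
        (k (γ i) + r (γ i) + n i / 2) - r i - n i / 2) P := by
  have h (k : Fin p → ℂ) (P : MvPolynomial (Fin p) K) :
    MvPolynomial.eval₂ K.subtype k P = MvPolynomial.aeval (R := K) k P := rfl
  rw [h, h, signedPerm, MvPolynomial.comp_aeval_apply]
  congr 2
  ext i
  rw [← Polynomial.aeval_algHom_apply, MvPolynomial.aeval_X]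
  have h2 : algebraMap K ℂ 2 = 2 := rfl
  simp [affine, h2]
  ring

lemma signedPerm_eq {n A r : Fin p → ℕ} {ε : Fin p → ℤˣ} {γ : Equiv.Perm (Fin p)}
    (hn : ∀ i, n (γ i) = n i) (hA : ∀ i, A (γ i) = A i) {P : MvPolynomial (Fin p) K} {c : K}
    (h : ∀ k : Fin p → ℂ, MvPolynomial.eval₂ K.subtype (fun i => ((ε (γ i) : ℤ) : ℂ) *
        (k (γ i) + r (γ i) + n i / 2) - r i - n i / 2) P /
          ∏ i, ((ascPochhammer ℂ (n i + 1)).eval (((ε (γ i) : ℤ) : ℂ) *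
            (k (γ i) + r (γ i) + n i / 2) - r i - n i / 2 + r i)) ^ A i =
        c * (MvPolynomial.eval₂ K.subtype k P /
          ∏ i, ((ascPochhammer ℂ (n i + 1)).eval (k i + r i)) ^ A i)) :
    signedPerm n r ε γ P = (c * ∏ i, ((ε i : ℤ) : K) ^ (A i * (n i + 1))) • P := by
  refine MvPolynomial.map_injective K.subtype K.subtype.injective ?_
  refine MvPolynomial.funext_set (fun _ => Set.range fun m : ℕ => ((m + 1 : ℕ) : ℂ))
    (fun _ => Set.infinite_range_of_injective fun a b hab => ?_) fun k hk => ?_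
  · simpa using hab
  · choose m hm using fun i => hk i (Set.mem_univ i)
    have hD : ∏ i, ((ascPochhammer ℂ (n i + 1)).eval (k i + r i)) ^ A i ≠ 0 := by
      refine prod_ne_zero_iff.2 fun i _ => pow_ne_zero _ ?_
      rw [ascPochhammer_eval_eq_prod, ← show ((m i + 1 : ℕ) : ℂ) = k i from hm i]
      refine prod_ne_zero_iff.2 fun j _ => ?_
      have : (m i + 1 + r i + j.1 : ℕ) ≠ 0 := by omega
      exact_mod_cast this
    have hE : ∏ i, ((ε i : ℤ) : ℂ) ^ (A i * (n i + 1)) ≠ 0 :=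
      prod_ne_zero_iff.2 fun i _ => pow_ne_zero _ (by exact_mod_cast (ε i).ne_zero)
    have h1 : ∏ i, ((ascPochhammer ℂ (n i + 1)).eval (((ε (γ i) : ℤ) : ℂ) *
          (k (γ i) + r (γ i) + n i / 2) - r i - n i / 2 + r i)) ^ A i =
        (∏ i, ((ε i : ℤ) : ℂ) ^ (A i * (n i + 1))) *
          ∏ i, ((ascPochhammer ℂ (n i + 1)).eval (k i + r i)) ^ A i := by
      rw [← prod_mul_distrib]
      refine Eq.trans (prod_congr rfl fun i _ => ?_) (Equiv.prod_comp γ _)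
      rw [hn, hA, mul_comm (A i), pow_mul, ← mul_pow, ← ascPochhammer_eval_reflect]
      congr 2
      ring
    have h2 := h k
    rw [h1, ← eval₂_signedPerm] at h2
    rw [MvPolynomial.eval_map, MvPolynomial.eval_map, MvPolynomial.smul_eq_C_mul,
      MvPolynomial.eval₂_mul, MvPolynomial.eval₂_C]
    simp only [map_mul, map_prod, map_pow, map_intCast]
    field_simp at h2
    rw [h2, Subfield.subtype_apply, mul_comm (∏ i, _)]

lemma multiPoleCoeff_comp_perm {n A r : Fin p → ℕ} {ε : Fin p → ℤˣ} {γ : Equiv.Perm (Fin p)}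
    (hn : ∀ i, n (γ i) = n i) (hA : ∀ i, A (γ i) = A i) {P : MvPolynomial (Fin p) K} {c : K}
    (h : signedPerm n r ε γ P = (c * ∏ i, ((ε i : ℤ) : K) ^ (A i * (n i + 1))) • P)
    (s : Fin p → ℕ) :
    (∏ i, ((ε i : ℤ) : K) ^ s i) * multiPoleCoeff n A r (fun i => s (γ i)) P =
      c * multiPoleCoeff n A r s P := by
  have hE : ∏ i, ((ε i : ℤ) : K) ^ (A i * (n i + 1)) ≠ 0 :=
    prod_ne_zero_iff.2 fun i _ => pow_ne_zero _ (by exact_mod_cast (ε i).ne_zero)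
  have h1 := multiPoleCoeff_signedPerm r s ε hn hA P
  rw [h, map_smul, smul_eq_mul] at h1
  simp only [pow_add, prod_mul_distrib] at h1 ⊢
  refine mul_left_cancel₀ hE ?_
  rw [← mul_assoc, ← h1]
  ring

lemma exists_sum_of_mem_mzvSpan {x : ℂ} (hx : x ∈ mzvSpan K p) :
    ∃ (T : Finset (List ℕ)) (c : List ℕ → K),
      (∀ s ∈ T, s.length < p ∧ (∀ a ∈ s, 1 ≤ a) ∧ (s ≠ [] → 2 ≤ s.headI)) ∧
      x = ∑ s ∈ T, (c s : ℂ) * (mzv s : ℂ) := by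
  obtain ⟨l, hl, rfl⟩ := (Finsupp.mem_span_image_iff_linearCombination K).1 hx
  exact ⟨l.support, l, fun s hs => hl hs, rfl⟩

end MultipleSum

end NestedSum

theorem statement10 (p : ℕ) (hp : 0 < p) (A n r : ℕ → ℕ) (K : Subfield ℂ)
    (P : MvPolynomial (Fin p) K)
    (H : Subgroup ((Fin p → ℤˣ) ⋊[permHom p] Equiv.Perm (Fin p)))
    (χ : H →* Kˣ)
    (hinv : ∀ g : H, ∀ i : Fin p,
      n ((g : (Fin p → ℤˣ) ⋊[permHom p] Equiv.Perm (Fin p)).right i).1 = n i.1 ∧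
      A ((g : (Fin p → ℤˣ) ⋊[permHom p] Equiv.Perm (Fin p)).right i).1 = A i.1)
    (hsym : ∀ g : H, ∀ k : Fin p → ℂ,
      Rfun p K A n r P (fun i =>
        ((((g : (Fin p → ℤˣ) ⋊[permHom p] Equiv.Perm (Fin p)).left
            ((g : (Fin p → ℤˣ) ⋊[permHom p] Equiv.Perm (Fin p)).right i) : ℤ) : ℂ)) *
          (k ((g : (Fin p → ℤˣ) ⋊[permHom p] Equiv.Perm (Fin p)).right i) +
            ((r ((g : (Fin p → ℤˣ) ⋊[permHom p] Equiv.Perm (Fin p)).right i).1 : ℂ)) +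
            ((n ((g : (Fin p → ℤˣ) ⋊[permHom p] Equiv.Perm (Fin p)).right i).1 : ℂ)) / 2)
        - (r i.1 : ℂ) - (n i.1 : ℂ) / 2)
        = ((χ g : K) : ℂ) * Rfun p K A n r P k)
    (h9 : ∀ j : Fin p, (∑ i ∈ Finset.Iic j, P.degreeOf i) + j.1 + 2 ≤
      ∑ i ∈ Finset.Iic j, A i.1 * (n i.1 + 1)) :
    Summable (fun k : {k : Fin p → ℕ // Antitone k ∧ ∀ i, 1 ≤ k i} =>
        Rfun p K A n r P (fun i => (k.1 i : ℂ))) ∧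
    ∃ (T : Finset (List ℕ)) (c : List ℕ → K) (lam : (Fin p → ℕ) → K),
      (∀ s ∈ T, s.length < p ∧ (∀ a ∈ s, 1 ≤ a) ∧ (s ≠ [] → 2 ≤ s.headI)) ∧
      (∀ s : Fin p → ℕ,
        ¬(2 ≤ s ⟨0, hp⟩ ∧ ∀ i : Fin p, 1 ≤ s i ∧ s i ≤ A i.1) → lam s = 0) ∧
      ((∑' k : {k : Fin p → ℕ // Antitone k ∧ ∀ i, 1 ≤ k i},
          Rfun p K A n r P (fun i => (k.1 i : ℂ)))
        = (∑ s ∈ T, (c s : ℂ) * (mzv s : ℂ)) +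
          ∑ s ∈ Fintype.piFinset (fun i : Fin p => Finset.Icc 1 (A i.1)),
            ((lam s : K) : ℂ) * (mzv (List.ofFn s) : ℂ)) ∧
      ∀ g : H, ∀ s : Fin p → ℕ,
        ((∏ i : Fin p,
            ((g : (Fin p → ℤˣ) ⋊[permHom p] Equiv.Perm (Fin p)).left i : ℤ) ^ s i : ℤ) : K) *
            lam (fun i => s ((g : (Fin p → ℤˣ) ⋊[permHom p] Equiv.Perm (Fin p)).right i))
          = (χ g : K) * lam s := by
  obtain ⟨h1, h2⟩ := NestedSum.summable_and_tsum_sub_mem hp (fun i => n i.1) (fun i => A i.1)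
    (fun i => r i.1) P h9
  obtain ⟨T, c, hT, hc⟩ := NestedSum.exists_sum_of_mem_mzvSpan h2
  refine ⟨h1, T, c, fun s =>
    NestedSum.multiPoleCoeff (fun i => n i.1) (fun i => A i.1) (fun i => r i.1) s P, hT,
    fun s hs => ?_, sub_eq_iff_eq_add.1 hc, fun g s => ?_⟩
  · by_cases h : ∀ i : Fin p, 1 ≤ s i ∧ s i ≤ A i.1
    · have h0 : s ⟨0, hp⟩ = 1 := by
        have := (h ⟨0, hp⟩).1
        by_contra h'
        exact hs ⟨by omega, h⟩
      have h3 := h9 ⟨0, hp⟩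
      have h4 : Finset.Iic (⟨0, hp⟩ : Fin p) = {⟨0, hp⟩} := by
        ext i
        simp [Fin.le_def, Fin.ext_iff]
      rw [h4, Finset.sum_singleton, Finset.sum_singleton] at h3
      exact NestedSum.multiPoleCoeff_eq_zero_of_eq_one h0 h3
    · push Not at h
      obtain ⟨i, hi⟩ := h
      exact NestedSum.multiPoleCoeff_eq_zero (i := i) (by simpa using hi) P
  · push_cast
    refine NestedSum.multiPoleCoeff_comp_perm (n := fun i => n i.1) (A := fun i => A i.1)
      (fun i => (hinv g i).1) (fun i => (hinv g i).2)
      (NestedSum.signedPerm_eq (fun i => (hinv g i).1) (fun i => (hinv g i).2) fun k => ?_) s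
    simpa only [Rfun, (hinv g _).1] using hsym g k
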